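/- arXiv:2511.09300 — 3 statements merged into one kernel-verified Lean document; each statement's English description precedes it below -/
import Mathlib

section
/- Let β, γ ∈ (0,1) with β + γ > 1, and let f ∈ C^β([0,T]), g ∈ C^γ([0,T]). Then for any 0 ≤ s < t ≤ T, the dyadic Riemann sums S_n = Σ_{i=0}^{2^n−1} f(s + i(t−s)/2^n) · [g(s + (i+1)(t−s)/2^n) − g(s + i(t−s)/2^n)] converge as n → ∞ (their limit defining the Young integral ∫_s^t f_r dg_r), and this limit satisfies |∫_s^t f_r dg_r − f_s (g_t − g_s)| ≤ C_{β,γ} [f]_β [g]_γ |t−s|^{β+γ}, where one may take C_{β,γ} = 2^{−(β+γ)} (1 − 2^{1−(β+γ)})^{−1}. -/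
open Set Filter

/-- A sum over `2 * N` consecutive indices, grouped in pairs. -/
theorem sum_range_two_mul_eq_sum_pairs {M : Type*} [AddCommMonoid M] (u : ℕ → M) (N : ℕ) :
    ∑ i ∈ Finset.range (2 * N), u i = ∑ i ∈ Finset.range N, (u (2 * i) + u (2 * i + 1)) := by
  induction N with
  | zero => simp
  | succ N ih =>
    rw [Finset.sum_range_succ, ← ih, mul_add, mul_one, Finset.sum_range_succ,
      Finset.sum_range_succ, add_assoc]

/-- The constant in a Hölder-type bound on a nontrivial interval is nonnegative. -/
theorem holder_const_nonneg {T β C : ℝ} (hT : 0 < T) {f : ℝ → ℝ}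
    (hf : ∀ x ∈ Set.Icc (0:ℝ) T, ∀ y ∈ Set.Icc (0:ℝ) T, |f x - f y| ≤ C * |x - y| ^ β) :
    0 ≤ C := by
  have h := (abs_nonneg _).trans (hf T ⟨hT.le, le_rfl⟩ 0 ⟨le_rfl, hT.le⟩)
  rw [sub_zero, abs_of_pos hT] at h
  exact nonneg_of_mul_nonneg_left h (Real.rpow_pos_of_pos hT β)

/-- Halving the mesh changes a dyadic left Riemann sum by the sum of the products
`(f m - f a) * (g b - g m)` over the intervals `[a, b]` with midpoint `m`. -/
theorem dyadic_sum_succ_sub (f g : ℝ → ℝ) (s h : ℝ) (n : ℕ) :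
    ∑ i ∈ Finset.range (2 ^ (n + 1)),
        f (s + (i : ℝ) * h / 2 ^ (n + 1)) *
          (g (s + ((i : ℝ) + 1) * h / 2 ^ (n + 1)) - g (s + (i : ℝ) * h / 2 ^ (n + 1))) -
      ∑ i ∈ Finset.range (2 ^ n),
        f (s + (i : ℝ) * h / 2 ^ n) *
          (g (s + ((i : ℝ) + 1) * h / 2 ^ n) - g (s + (i : ℝ) * h / 2 ^ n)) =
    ∑ i ∈ Finset.range (2 ^ n),
      (f (s + (2 * (i : ℝ) + 1) * h / 2 ^ (n + 1)) - f (s + (2 * (i : ℝ)) * h / 2 ^ (n + 1))) *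
        (g (s + (2 * (i : ℝ) + 2) * h / 2 ^ (n + 1)) -
          g (s + (2 * (i : ℝ) + 1) * h / 2 ^ (n + 1))) := by
  rw [show 2 ^ (n + 1) = 2 * 2 ^ n from pow_succ' 2 n, sum_range_two_mul_eq_sum_pairs,
    ← Finset.sum_sub_distrib]
  refine Finset.sum_congr rfl fun i _ => ?_
  have h₀ : (i : ℝ) * h / 2 ^ n = 2 * (i : ℝ) * h / 2 ^ (n + 1) := by
    rw [pow_succ]; field_simp
  have h₁ : ((i : ℝ) + 1) * h / 2 ^ n = (2 * (i : ℝ) + 2) * h / 2 ^ (n + 1) := by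
    rw [pow_succ]; field_simp
  rw [h₀, h₁]
  push_cast
  rw [show 2 * (i : ℝ) + 1 + 1 = 2 * i + 2 by ring]
  ring

/-- Consecutive dyadic Riemann sums of Hölder functions differ by at most a geometric sequence. -/
theorem abs_dyadic_sum_succ_sub_le {T β γ Cf Cg : ℝ} (hT : 0 < T) {f g : ℝ → ℝ}
    (hf : ∀ x ∈ Set.Icc (0:ℝ) T, ∀ y ∈ Set.Icc (0:ℝ) T, |f x - f y| ≤ Cf * |x - y| ^ β)
    (hg : ∀ x ∈ Set.Icc (0:ℝ) T, ∀ y ∈ Set.Icc (0:ℝ) T, |g x - g y| ≤ Cg * |x - y| ^ γ)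
    {s h : ℝ} (hs : 0 ≤ s) (hh : 0 < h) (hsh : s + h ≤ T) (n : ℕ) :
    |∑ i ∈ Finset.range (2 ^ (n + 1)),
        f (s + (i : ℝ) * h / 2 ^ (n + 1)) *
          (g (s + ((i : ℝ) + 1) * h / 2 ^ (n + 1)) - g (s + (i : ℝ) * h / 2 ^ (n + 1))) -
      ∑ i ∈ Finset.range (2 ^ n),
        f (s + (i : ℝ) * h / 2 ^ n) *
          (g (s + ((i : ℝ) + 1) * h / 2 ^ n) - g (s + (i : ℝ) * h / 2 ^ n))| ≤
    (2 : ℝ) ^ (-(β + γ)) * Cf * Cg * h ^ (β + γ) * ((2 : ℝ) ^ (1 - (β + γ))) ^ n := by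
  have hCf := holder_const_nonneg hT hf
  have hCg := holder_const_nonneg hT hg
  have hmem : ∀ x : ℝ, 0 ≤ x → x ≤ 2 ^ (n + 1) → s + x * h / 2 ^ (n + 1) ∈ Set.Icc 0 T := by
    intro x h0 h1
    refine ⟨by positivity, le_trans ?_ hsh⟩
    gcongr
    rw [div_le_iff₀ (by positivity), mul_comm]
    gcongr
  have hd : 0 < h / 2 ^ (n + 1) := by positivity
  have hinc : ∀ x y : ℝ, x - y = 1 →
      |s + x * h / 2 ^ (n + 1) - (s + y * h / 2 ^ (n + 1))| = h / 2 ^ (n + 1) := by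
    intro x y hxy
    rw [show s + x * h / 2 ^ (n + 1) - (s + y * h / 2 ^ (n + 1)) =
      (x - y) * (h / 2 ^ (n + 1)) by ring, hxy, one_mul, abs_of_pos hd]
  rw [dyadic_sum_succ_sub]
  calc _ ≤ ∑ _i ∈ Finset.range (2 ^ n), Cf * Cg * (h / 2 ^ (n + 1)) ^ (β + γ) := by
        refine (Finset.abs_sum_le_sum_abs _ _).trans (Finset.sum_le_sum fun i hi => ?_)
        have hi' : (i : ℝ) + 1 ≤ 2 ^ n := by
          exact_mod_cast Finset.mem_range.mp hi
        have hi₀ : (0 : ℝ) ≤ i := i.cast_nonneg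
        have hpow : (2 : ℝ) ^ (n + 1) = 2 * 2 ^ n := pow_succ' 2 n
        have m₀ := hmem (2 * i) (by linarith) (by linarith)
        have m₁ := hmem (2 * i + 1) (by linarith) (by linarith)
        have m₂ := hmem (2 * i + 2) (by linarith) (by linarith)
        have hF := hf _ m₁ _ m₀
        have hG := hg _ m₂ _ m₁
        rw [hinc _ _ (by ring)] at hF hG
        rw [abs_mul, Real.rpow_add hd, mul_mul_mul_comm]
        exact mul_le_mul hF hG (abs_nonneg _) (by positivity)
    _ = _ := by
        rw [Finset.sum_const, Finset.card_range, nsmul_eq_mul,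
          Real.div_rpow hh.le (by positivity), ← Real.rpow_natCast, ← Real.rpow_natCast,
          ← Real.rpow_mul two_pos.le, ← Real.rpow_mul two_pos.le, div_eq_mul_inv,
          ← Real.rpow_neg two_pos.le]
        push_cast
        rw [← Real.rpow_natCast 2 n]
        have key : (2 : ℝ) ^ (n : ℝ) * 2 ^ (-(((n : ℝ) + 1) * (β + γ))) =
            2 ^ (-(β + γ)) * 2 ^ ((1 - (β + γ)) * n) := by
          rw [← Real.rpow_add two_pos, ← Real.rpow_add two_pos]
          congr 1
          ring
        linear_combination Cf * Cg * h ^ (β + γ) * key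

/-- **Young integral via dyadic Riemann sums.**
If `f` is `β`-Hölder and `g` is `γ`-Hölder on `[0,T]` with `β + γ > 1`, then for
`0 ≤ s < t ≤ T` the dyadic left Riemann sums converge; their limit (the Young
integral `∫_s^t f dg`) satisfies
`|∫_s^t f dg - f s (g t - g s)| ≤ 2^{-(β+γ)} (1 - 2^{1-(β+γ)})⁻¹ [f]_β [g]_γ (t-s)^{β+γ}`. -/
theorem stmt_1 (T β γ : ℝ) (hT : 0 < T)
    (hβ : β ∈ Set.Ioo (0:ℝ) 1) (hγ : γ ∈ Set.Ioo (0:ℝ) 1) (hβγ : 1 < β + γ)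
    (f g : ℝ → ℝ) (Cf Cg : ℝ)
    (hf : ∀ x ∈ Set.Icc (0:ℝ) T, ∀ y ∈ Set.Icc (0:ℝ) T, |f x - f y| ≤ Cf * |x - y| ^ β)
    (hg : ∀ x ∈ Set.Icc (0:ℝ) T, ∀ y ∈ Set.Icc (0:ℝ) T, |g x - g y| ≤ Cg * |x - y| ^ γ)
    (s t : ℝ) (hs : 0 ≤ s) (hst : s < t) (ht : t ≤ T) :
    ∃ I : ℝ,
      Tendsto
        (fun n : ℕ => ∑ i ∈ Finset.range (2 ^ n),
          f (s + (i : ℝ) * (t - s) / 2 ^ n) *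
            (g (s + ((i : ℝ) + 1) * (t - s) / 2 ^ n) - g (s + (i : ℝ) * (t - s) / 2 ^ n)))
        atTop (nhds I) ∧
      |I - f s * (g t - g s)| ≤
        (2 : ℝ) ^ (-(β + γ)) * (1 - (2 : ℝ) ^ (1 - (β + γ)))⁻¹ * Cf * Cg * (t - s) ^ (β + γ) := by
  have hr : (2 : ℝ) ^ (1 - (β + γ)) < 1 :=
    Real.rpow_lt_one_of_one_lt_of_neg one_lt_two (by linarith)
  have hstep := fun n => (Real.dist_eq _ _).trans_le ((abs_sub_comm _ _).trans_le
    (abs_dyadic_sum_succ_sub_le hT hf hg hs (sub_pos.mpr hst) (by linarith) n))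
  obtain ⟨I, hI⟩ := cauchySeq_tendsto_of_complete (cauchySeq_of_le_geometric _ _ hr hstep)
  refine ⟨I, hI, ?_⟩
  have hdist := dist_le_of_le_geometric_of_tendsto₀ _ _ hr hstep hI
  rw [dist_comm, Real.dist_eq] at hdist
  simp only [pow_zero, Finset.range_one, Finset.sum_singleton, Nat.cast_zero, zero_mul, zero_add,
    one_mul, div_one, add_zero, add_sub_cancel] at hdist
  refine hdist.trans_eq ?_
  rw [div_eq_mul_inv]
  ring
end

section
/- Let {U_t, 0 ≤ t ≤ 1} be a separable centered Gaussian process with U_0 = 0, and set V_h^t = E[(U_{t+h} − U_t)²]. Let V : [0,1] → [0,∞) be such that h ↦ √(V_h) is concave and √(V_h) / √(V_h^t) ≥ c_* for some c_* > 0 and all 0 ≤ t, h with t + h ≤ 1. Let f ∈ C_0[0,1] be nondecreasing and strictly positive on (0,1], and suppose that for some β > 0 the map ε ↦ √(V_ε) / (ε^β f(ε)) is nondecreasing on (0,1]. Then there exists a constant M_β > 0, depending only on β and c_*, such that for all ε ∈ (0,1], P( sup_{0 ≤ s ≠ t ≤ 1} |U_t − U_s| / f(|t−s|) ≤ √(V_ε)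 / f(ε) ) ≥ exp(−M_β / ε). -/
open MeasureTheory Set Filter

noncomputable section

/-- A process is a centered Gaussian process if every finite real linear combination of its
marginals has a centered Gaussian law. -/
def IsCenteredGaussianProcess {Ω : Type*} [MeasurableSpace Ω] (P : Measure Ω)
    (U : ℝ → Ω → ℝ) : Prop :=
  ∀ (n : ℕ) (c : Fin n → ℝ) (t : Fin n → ℝ), ∃ v : NNReal,
    Measure.map (fun ω => ∑ i, c i * U (t i) ω) P = ProbabilityTheory.gaussianReal 0 v

/-- Doob separability of a real process on `[0,1]`: there is a countable set `D ⊆ [0,1]` such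
that a.s. every value `U_t` is approximated by values `U_s` with `s ∈ D` near `t`. -/
def IsSeparableProcess {Ω : Type*} [MeasurableSpace Ω] (P : Measure Ω)
    (U : ℝ → Ω → ℝ) : Prop :=
  ∃ D : Set ℝ, D.Countable ∧ D ⊆ Icc 0 1 ∧
    ∀ᵐ ω ∂P, ∀ t ∈ Icc (0:ℝ) 1, ∀ δ > 0,
      U t ω ∈ closure ((fun s => U s ω) '' (D ∩ Ioo (t - δ) (t + δ)))

/-- A nonnegative function `F` on a real vector space is log-concave. -/
def IsLogConcave {E : Type*} [AddCommGroup E] [Module ℝ E] (F : E → ℝ) : Prop :=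
  (∀ x, 0 ≤ F x) ∧ ∀ x y : E, ∀ a b : ℝ, 0 < a → 0 < b → a + b = 1 →
    F x ^ a * F y ^ b ≤ F (a • x + b • y)

namespace IsLogConcave

variable {E E' : Type*} [AddCommGroup E] [Module ℝ E] [AddCommGroup E'] [Module ℝ E'] {F G : E → ℝ}

lemma mul (hF : IsLogConcave F) (hG : IsLogConcave G) : IsLogConcave (fun x => F x * G x) := by
  refine ⟨fun x => mul_nonneg (hF.1 x) (hG.1 x), fun x y a b ha hb hab => ?_⟩
  rw [Real.mul_rpow (hF.1 _) (hG.1 _), Real.mul_rpow (hF.1 _) (hG.1 _), mul_mul_mul_comm]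
  exact mul_le_mul (hF.2 x y a b ha hb hab) (hG.2 x y a b ha hb hab)
    (mul_nonneg (Real.rpow_nonneg (hG.1 _) _) (Real.rpow_nonneg (hG.1 _) _)) (hF.1 _)

lemma comp_add_linearMap (hF : IsLogConcave F) (v : E) (L : E' →ₗ[ℝ] E) :
    IsLogConcave (fun x => F (v + L x)) := by
  refine ⟨fun x => hF.1 _, fun x y a b ha hb hab => ?_⟩
  refine (hF.2 (v + L x) (v + L y) a b ha hb hab).trans_eq (congrArg F ?_)
  have : v = a • v + b • v := by rw [← add_smul, hab, one_smul]
  conv_rhs => rw [this]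
  simp only [smul_add, map_add, map_smul]
  abel

/-- Superlevel sets of a log-concave function are convex. -/
lemma convex_superlevel (hF : IsLogConcave F) {t : ℝ} (ht : 0 < t) :
    Convex ℝ {x | t < F x} := by
  rw [convex_iff_forall_pos]
  intro x hx y hy a b ha hb hab
  refine lt_of_lt_of_le ?_ (hF.2 x y a b ha hb hab)
  calc t = t ^ a * t ^ b := by rw [← Real.rpow_add ht, hab, Real.rpow_one]
    _ < F x ^ a * F y ^ b :=
      mul_lt_mul'' (Real.rpow_lt_rpow ht.le hx ha) (Real.rpow_lt_rpow ht.le hy hb)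
        (by positivity) (by positivity)

/-- An even log-concave function is nonincreasing along rays. -/
lemma le_of_even {g : ℝ → ℝ} (hg : IsLogConcave g) (heven : ∀ x, g (-x) = g x) {x y : ℝ}
    (hxy : |x| ≤ |y|) : g y ≤ g x := by
  rcases hxy.lt_or_eq with h | h
  · have hy : 0 < |y| := (abs_nonneg x).trans_lt h
    have hgy : g |y| = g y := by
      rcases abs_choice y with h | h <;> rw [h]
      exact heven y
    have h1 := neg_abs_le x
    have hx := abs_lt.1 h
    have := hg.2 |y| (-|y|) ((1 + x / |y|) / 2) ((1 - x / |y|) / 2)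
      (by have : -1 < x / |y| := by rw [lt_div_iff₀ hy]; linarith
          linarith)
      (by have : x / |y| < 1 := by rw [div_lt_iff₀ hy]; linarith
          linarith) (by ring)
    have e : ((1 + x / |y|) / 2) • |y| + ((1 - x / |y|) / 2) • (-|y|) = x := by
      simp only [smul_eq_mul]; field_simp; ring
    rw [e, heven, hgy, ← Real.rpow_add_of_nonneg (hg.1 y)] at this
    · convert this using 1
      rw [show (1 + x / |y|) / 2 + (1 - x / |y|) / 2 = 1 by ring, Real.rpow_one]
    · have : -1 < x / |y| := by rw [lt_div_iff₀ hy]; linarith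
      linarith
    · have : x / |y| < 1 := by rw [div_lt_iff₀ hy]; linarith
      linarith
  · rcases abs_eq_abs.1 h with rfl | rfl
    · exact le_rfl
    · rw [heven]

end IsLogConcave

/-- One-dimensional Brunn–Minkowski inequality for sets whose Minkowski combination lies in a
convex set. -/
lemma volume_add_volume_le {A B C : Set ℝ} {a b : ℝ} (ha : 0 < a) (hb : 0 < b)
    (hA : A.Nonempty) (hB : B.Nonempty) (hC : Convex ℝ C)
    (h : ∀ x ∈ A, ∀ y ∈ B, a * x + b * y ∈ C) :
    ENNReal.ofReal a * volume A + ENNReal.ofReal b * volume B ≤ volume C := by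
  refine (add_le_add (mul_le_mul_right (Real.volume_le_diam A) _)
    (mul_le_mul_right (Real.volume_le_diam B) _)).trans ?_
  have key : ∀ p ∈ A ×ˢ A, ∀ q ∈ B ×ˢ B,
      ENNReal.ofReal a * edist p.1 p.2 + ENNReal.ofReal b * edist q.1 q.2 ≤ volume C := by
    have aux : ∀ x₁ ∈ A, ∀ x₂ ∈ A, ∀ y₁ ∈ B, ∀ y₂ ∈ B, x₁ ≤ x₂ → y₁ ≤ y₂ →
        ENNReal.ofReal a * edist x₁ x₂ + ENNReal.ofReal b * edist y₁ y₂ ≤ volume C := by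
      intro x₁ hx₁ x₂ hx₂ y₁ hy₁ y₂ hy₂ hx hy
      have hsub : Icc (a * x₁ + b * y₁) (a * x₂ + b * y₂) ⊆ C :=
        hC.ordConnected.out (h _ hx₁ _ hy₁) (h _ hx₂ _ hy₂)
      refine le_trans (le_of_eq ?_) (measure_mono hsub)
      rw [Real.volume_Icc, edist_dist, edist_dist, ← ENNReal.ofReal_mul ha.le,
        ← ENNReal.ofReal_mul hb.le, ← ENNReal.ofReal_add (by positivity) (by positivity),
        dist_comm x₁, dist_comm y₁, Real.dist_eq, Real.dist_eq, abs_of_nonneg (by linarith),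
        abs_of_nonneg (by linarith)]
      congr 1; ring
    rintro ⟨x₁, x₂⟩ ⟨hx₁, hx₂⟩ ⟨y₁, y₂⟩ ⟨hy₁, hy₂⟩
    simp only at *
    rcases le_total x₁ x₂ with hx | hx <;> rcases le_total y₁ y₂ with hy | hy
    · exact aux _ hx₁ _ hx₂ _ hy₁ _ hy₂ hx hy
    · rw [edist_comm y₁]; exact aux _ hx₁ _ hx₂ _ hy₂ _ hy₁ hx hy
    · rw [edist_comm x₁]; exact aux _ hx₂ _ hx₁ _ hy₁ _ hy₂ hx hy
    · rw [edist_comm x₁, edist_comm y₁]; exact aux _ hx₂ _ hx₁ _ hy₂ _ hy₁ hx hy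
  have e : ∀ S : Set ℝ, Metric.ediam S = ⨆ p ∈ S ×ˢ S, edist p.1 p.2 := by
    intro S
    rw [Metric.ediam, biSup_prod]
  rw [e, e]
  simp only [ENNReal.mul_iSup]
  exact ENNReal.biSup_add_biSup_le' (hA.prod hA) (hB.prod hB) key

/-- One-dimensional Prékopa–Leindler inequality with a log-concave upper function. -/
lemma prekopa_leindler {f g h : ℝ → ℝ} {a b M : ℝ} (ha : 0 < a) (hb : 0 < b) (hab : a + b = 1)
    (hf0 : ∀ x, 0 ≤ f x) (hg0 : ∀ x, 0 ≤ g x) (hh : IsLogConcave h)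
    (hfM : ∀ x, f x ≤ M) (hgM : ∀ x, g x ≤ M)
    (hf : Integrable f) (hg : Integrable g) (hhi : Integrable h)
    (hfgh : ∀ x y, f x ^ a * g y ^ b ≤ h (a * x + b * y)) :
    (∫ x, f x) ^ a * (∫ x, g x) ^ b ≤ ∫ x, h x := by
  have hI : 0 ≤ ∫ x, h x := integral_nonneg fun x => hh.1 x
  rcases (show 0 ≤ ∫ x, f x from integral_nonneg fun x => hf0 x).eq_or_lt with h0 | hfpos
  · rw [show ∫ x, f x = 0 from h0.symm, Real.zero_rpow ha.ne', zero_mul]; exact hI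
  rcases (show 0 ≤ ∫ x, g x from integral_nonneg fun x => hg0 x).eq_or_lt with h0 | hgpos
  · rw [show ∫ x, g x = 0 from h0.symm, Real.zero_rpow hb.ne', mul_zero]; exact hI
  have sup_pos : ∀ u : ℝ → ℝ, (∀ x, u x ≤ M) → 0 < ∫ x, u x → 0 < ⨆ x, u x := by
    intro u huM hu
    by_contra! hc
    refine hu.not_ge (integral_nonpos fun x => ?_)
    exact (le_ciSup ⟨M, by rintro _ ⟨x, rfl⟩; exact huM x⟩ x).trans hc
  have hα := sup_pos f hfM hfpos
  have hβ := sup_pos g hgM hgpos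
  have hfα : ∀ x, f x ≤ ⨆ x, f x := fun x => le_ciSup ⟨M, by rintro _ ⟨x, rfl⟩; exact hfM x⟩ x
  have hgβ : ∀ x, g x ≤ ⨆ x, g x := fun x => le_ciSup ⟨M, by rintro _ ⟨x, rfl⟩; exact hgM x⟩ x
  set α := ⨆ x, f x with hαd
  set β := ⨆ x, g x with hβd
  have hγ : 0 < α ^ a * β ^ b := by positivity
  set γ := α ^ a * β ^ b with hγd
  have level : ∀ t ∈ Ioi (0 : ℝ), ENNReal.ofReal a * volume {x | t < f x / α} +
      ENNReal.ofReal b * volume {x | t < g x / β} ≤ volume {x | t < h x / γ} := by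
    intro t ht
    have ht0 : 0 < t := ht
    rcases lt_or_ge t 1 with h1 | h1
    · refine volume_add_volume_le ha hb ?_ ?_ ?_ ?_
      · obtain ⟨x, hx⟩ := exists_lt_of_lt_ciSup (show t * α < ⨆ x, f x by
          rw [← hαd]; nlinarith)
        exact ⟨x, by simpa [lt_div_iff₀ hα] using hx⟩
      · obtain ⟨x, hx⟩ := exists_lt_of_lt_ciSup (show t * β < ⨆ x, g x by
          rw [← hβd]; nlinarith)
        exact ⟨x, by simpa [lt_div_iff₀ hβ] using hx⟩
      · have := hh.convex_superlevel (mul_pos ht0 hγ)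
        simpa [lt_div_iff₀ hγ] using this
      · intro x hx y hy
        simp only [mem_ofPred_eq, lt_div_iff₀ hα, lt_div_iff₀ hβ, lt_div_iff₀ hγ] at hx hy ⊢
        refine lt_of_lt_of_le ?_ (hfgh x y)
        calc t * γ = (t ^ a * t ^ b) * γ := by rw [← Real.rpow_add ht0, hab, Real.rpow_one]
          _ = (t * α) ^ a * (t * β) ^ b := by
            rw [Real.mul_rpow ht0.le hα.le, Real.mul_rpow ht0.le hβ.le, hγd]; ring
          _ < f x ^ a * g y ^ b :=
            mul_lt_mul'' (Real.rpow_lt_rpow (by positivity) hx ha)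
              (Real.rpow_lt_rpow (by positivity) hy hb) (by positivity) (by positivity)
    · have e1 : {x | t < f x / α} = ∅ := by
        ext x; simp only [mem_ofPred_eq, mem_empty_iff_false, iff_false, not_lt]
        exact ((div_le_one hα).2 (hfα x)).trans h1
      have e2 : {x | t < g x / β} = ∅ := by
        ext x; simp only [mem_ofPred_eq, mem_empty_iff_false, iff_false, not_lt]
        exact ((div_le_one hβ).2 (hgβ x)).trans h1
      simp [e1, e2]
  have layer : ∀ u : ℝ → ℝ, (∀ x, 0 ≤ u x) → Integrable u → ∀ c > 0,
      ENNReal.ofReal ((∫ x, u x) / c) = ∫⁻ t in Ioi (0 : ℝ), volume {x | t < u x / c} := by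
    intro u hu hui c hc
    rw [← lintegral_eq_lintegral_meas_lt volume
      (Eventually.of_forall fun x => div_nonneg (hu x) hc.le) (hui.div_const c).aemeasurable,
      ← ofReal_integral_eq_lintegral_ofReal (hui.div_const c)
      (Eventually.of_forall fun x => div_nonneg (hu x) hc.le), integral_div]
  have main : a * ((∫ x, f x) / α) + b * ((∫ x, g x) / β) ≤ (∫ x, h x) / γ := by
    rw [← ENNReal.ofReal_le_ofReal_iff (by positivity), ENNReal.ofReal_add (by positivity)
      (by positivity), ENNReal.ofReal_mul ha.le, ENNReal.ofReal_mul hb.le, layer f hf0 hf α hα,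
      layer g hg0 hg β hβ, layer h hh.1 hhi γ hγ, ← lintegral_const_mul' _ _ ENNReal.ofReal_ne_top,
      ← lintegral_const_mul' _ _ ENNReal.ofReal_ne_top]
    exact (le_lintegral_add _ _).trans (setLIntegral_mono' measurableSet_Ioi level)
  have amgm := Real.geom_mean_le_arith_mean2_weighted ha.le hb.le
    (div_nonneg hfpos.le hα.le) (div_nonneg hgpos.le hβ.le) hab
  have := amgm.trans main
  rw [Real.div_rpow hfpos.le hα.le, Real.div_rpow hgpos.le hβ.le, div_mul_div_comm, ← hγd,
    div_le_div_iff_of_pos_right hγ] at this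
  exact this

lemma isLogConcave_gaussianPDFReal (v : NNReal) :
    IsLogConcave (ProbabilityTheory.gaussianPDFReal 0 v) := by
  refine ⟨fun x => ProbabilityTheory.gaussianPDFReal_nonneg _ _ _, fun x y a b ha hb hab => ?_⟩
  simp only [ProbabilityTheory.gaussianPDFReal, sub_zero, smul_eq_mul]
  have hc : 0 ≤ (√(2 * Real.pi * v))⁻¹ := by positivity
  rw [Real.mul_rpow hc (by positivity), Real.mul_rpow hc (by positivity), mul_mul_mul_comm,
    ← Real.rpow_add_of_nonneg hc ha.le hb.le, hab, Real.rpow_one, ← Real.exp_mul, ← Real.exp_mul,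
    ← Real.exp_add]
  refine mul_le_mul_of_nonneg_left (Real.exp_le_exp.2 ?_) hc
  have : (a * x + b * y) ^ 2 ≤ x ^ 2 * a + y ^ 2 * b := by
    obtain rfl : b = 1 - a := by linarith
    nlinarith [mul_nonneg (mul_nonneg ha.le hb.le) (sq_nonneg (x - y))]
  have h2 : (0:ℝ) ≤ 2 * v := by positivity
  rw [div_mul_eq_mul_div, div_mul_eq_mul_div, ← add_div]
  exact div_le_div_of_nonneg_right (by linarith) h2

/-- Averaging translates of a bounded log-concave function along a line against a centered Gaussian
law preserves log-concavity. -/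
lemma IsLogConcave.integral_gaussianReal {E : Type*} [AddCommGroup E] [Module ℝ E]
    {F : E → ℝ} (hF : IsLogConcave F) {M : ℝ} (hM : ∀ x, F x ≤ M) (c : E)
    (hmeas : ∀ b, Measurable fun x : ℝ => F (b + x • c)) (v : NNReal) :
    IsLogConcave (fun b => ∫ x, F (b + x • c) ∂(ProbabilityTheory.gaussianReal 0 v)) := by
  rcases eq_or_ne v 0 with rfl | hv
  · simp only [ProbabilityTheory.gaussianReal_zero_var, integral_dirac, zero_smul, add_zero]
    exact hF
  refine ⟨fun b => integral_nonneg fun x => hF.1 _, fun y z a b ha hb hab => ?_⟩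
  simp only [ProbabilityTheory.integral_gaussianReal_eq_integral_smul hv, smul_eq_mul]
  set φ := ProbabilityTheory.gaussianPDFReal 0 v with hφ
  have hφl := isLogConcave_gaussianPDFReal v
  have hφb : ∀ x, φ x ≤ (√(2 * Real.pi * v))⁻¹ := by
    intro x
    simp only [hφ, ProbabilityTheory.gaussianPDFReal, sub_zero]
    refine mul_le_of_le_one_right (by positivity) (Real.exp_le_one_iff.2 ?_)
    exact div_nonpos_of_nonpos_of_nonneg (by nlinarith [sq_nonneg x]) (by positivity)
  have hM0 : 0 ≤ M := (hF.1 0).trans (hM 0)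
  have hInt : ∀ b, Integrable fun x : ℝ => φ x * F (b + x • c) := by
    intro b
    refine (ProbabilityTheory.integrable_gaussianPDFReal 0 v).mul_bdd (c := M)
      (hmeas b).aestronglyMeasurable (Eventually.of_forall fun x => ?_)
    rw [Real.norm_of_nonneg (hF.1 _)]; exact hM _
  have hline : ∀ b, IsLogConcave fun x : ℝ => φ x * F (b + x • c) := fun b =>
    hφl.mul (hF.comp_add_linearMap b (LinearMap.toSpanSingleton ℝ E c))
  have hbd : ∀ b x, φ x * F (b + x • c) ≤ (√(2 * Real.pi * v))⁻¹ * M := fun b x =>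
    mul_le_mul (hφb x) (hM _) (hF.1 _) (by positivity)
  refine prekopa_leindler ha hb hab (hline y).1 (hline z).1 (hline _) (hbd y) (hbd z)
    (hInt y) (hInt z) (hInt _) fun s t => ?_
  rw [Real.mul_rpow (hφl.1 _) (hF.1 _), Real.mul_rpow (hφl.1 _) (hF.1 _), mul_mul_mul_comm]
  refine mul_le_mul (hφl.2 s t a b ha hb hab) ?_
    (mul_nonneg (Real.rpow_nonneg (hF.1 _) _) (Real.rpow_nonneg (hF.1 _) _)) (hφl.1 _)
  refine (hF.2 _ _ a b ha hb hab).trans_eq (congrArg F ?_)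
  module

open ProbabilityTheory in
/-- Regression of a centered Gaussian vector on one of its coordinates. -/
lemma exists_gaussian_regression {Ω ι : Type*} [MeasurableSpace Ω] {P : Measure Ω} [Finite ι]
    {Z : ι → Ω → ℝ} (hZ : HasGaussianLaw (fun ω i => Z i ω) P) (hZ0 : ∀ i, ∫ ω, Z i ω ∂P = 0)
    (i₀ : ι) :
    ∃ c : ι → ℝ, HasGaussianLaw (fun ω i => Z i ω - c i * Z i₀ ω) P ∧
      (∀ i, ∫ ω, (Z i ω - c i * Z i₀ ω) ∂P = 0) ∧
      IndepFun (Z i₀) (fun ω i => Z i ω - c i * Z i₀ ω) P ∧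
      (fun ω => Z i₀ ω - c i₀ * Z i₀ ω) =ᵐ[P] 0 ∧
      ∀ i, Z i =ᵐ[P] 0 → (fun ω => Z i ω - c i * Z i₀ ω) =ᵐ[P] 0 := by
  have := hZ.isProbabilityMeasure
  have hL2 : ∀ i, MemLp (Z i) 2 P := fun i => (hZ.eval i).memLp_two
  let c : ι → ℝ := fun i => cov[Z i₀, Z i; P] / cov[Z i₀, Z i₀; P]
  have hvar : cov[Z i₀, Z i₀; P] = 0 → Z i₀ =ᵐ[P] 0 := by
    intro h
    rw [covariance_self (hL2 i₀).aemeasurable] at h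
    have := ae_eq_integral_of_variance_eq_zero (hL2 i₀) h
    rw [hZ0 i₀] at this
    exact this
  have hz : ∀ i, cov[Z i₀, Z i₀; P] = 0 → cov[Z i₀, Z i; P] = 0 := by
    intro i h
    have e : Z i₀ =ᵐ[P] 0 := hvar h
    rw [covariance, hZ0, hZ0]
    refine integral_eq_zero_of_ae ?_
    filter_upwards [e] with ω hω
    simp [hω]
  let _ := Fintype.ofFinite ι
  let pr : ι → ((ι → ℝ) →L[ℝ] ℝ) := fun i => ContinuousLinearMap.proj i
  let L : (ι → ℝ) →L[ℝ] (ι → ℝ) := ContinuousLinearMap.pi fun i => pr i - c i • pr i₀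
  have hLaw : HasGaussianLaw (fun ω i => Z i ω - c i * Z i₀ ω) P :=
    hZ.map_fun L
  let L' : (ι → ℝ) →L[ℝ] ((Unit → ℝ) × (ι → ℝ)) :=
    (ContinuousLinearMap.pi fun _ => pr i₀).prod L
  have hJoint : HasGaussianLaw (fun ω => ((fun _ : Unit => Z i₀ ω),
      fun i => Z i ω - c i * Z i₀ ω)) P :=
    hZ.map_fun L'
  refine ⟨c, hLaw, fun i => ?_, ?_, ?_, fun i hi => ?_⟩
  · rw [integral_sub ((hL2 i).integrable one_le_two) (((hL2 i₀).integrable one_le_two).const_mul _),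
      integral_const_mul, hZ0, hZ0]; simp
  · have := hJoint.indepFun_of_covariance_eval (X := fun _ : Unit => Z i₀)
      (Y := fun i ω => Z i ω - c i * Z i₀ ω) ?_
    · exact this.comp (φ := fun x : Unit → ℝ => x ()) (ψ := id) (measurable_pi_apply ())
        measurable_id
    · intro _ i
      rw [covariance_fun_sub_right (hL2 i₀) (hL2 i) ((hL2 i₀).const_mul _),
        covariance_const_mul_right, sub_eq_zero]
      by_cases h : cov[Z i₀, Z i₀; P] = 0
      · rw [hz i h, h, mul_zero]
      · simp only [c]; field_simp
  · by_cases h : cov[Z i₀, Z i₀; P] = 0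
    · filter_upwards [hvar h] with ω hω
      simp [hω]
    · refine Eventually.of_forall fun ω => ?_
      simp only [c, div_self h]; simp
  · have hci : c i = 0 := by
      simp only [c]
      rw [covariance, hZ0, hZ0, div_eq_zero_iff]
      left
      refine integral_eq_zero_of_ae ?_
      filter_upwards [hi] with ω hω
      simp [hω]
    filter_upwards [hi] with ω hω
    simp [hω, hci]

open ProbabilityTheory in
lemma integral_indepFun_eq {Ω E : Type*} [MeasurableSpace Ω] [MeasurableSpace E] {P : Measure Ω}
    [IsProbabilityMeasure P] {X : Ω → ℝ} {Z : Ω → E} (hX : AEMeasurable X P)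
    (hZ : AEMeasurable Z P) (hXZ : IndepFun X Z P) {G : ℝ → E → ℝ}
    (hG : Measurable (Function.uncurry G)) {M : ℝ} (hM : ∀ x z, |G x z| ≤ M) :
    ∫ ω, G (X ω) (Z ω) ∂P = ∫ x, ∫ ω, G x (Z ω) ∂P ∂(P.map X) := by
  have := Measure.isProbabilityMeasure_map hX
  have := Measure.isProbabilityMeasure_map hZ
  have h1 := (indepFun_iff_map_prod_eq_prod_map_map hX hZ).1 hXZ
  calc ∫ ω, G (X ω) (Z ω) ∂P = ∫ p, Function.uncurry G p ∂(P.map fun ω => (X ω, Z ω)) := by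
        rw [integral_map (hX.prodMk hZ) hG.aestronglyMeasurable]; rfl
    _ = ∫ x, ∫ z, G x z ∂(P.map Z) ∂(P.map X) := by
        rw [h1, integral_prod]; · rfl
        exact Integrable.of_bound hG.aestronglyMeasurable M
          (Eventually.of_forall fun p => hM p.1 p.2)
    _ = _ := by
        congr 1; ext x
        exact integral_map hZ (hG.comp measurable_prodMk_left).aestronglyMeasurable

open ProbabilityTheory in
/-- Convolving a bounded log-concave function with a centered Gaussian law gives a log-concave
function. -/
lemma IsLogConcave.integral_gaussian {Ω ι : Type*} [MeasurableSpace Ω] {P : Measure Ω} [Finite ι]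
    {F : (ι → ℝ) → ℝ} (hF : IsLogConcave F) (hFm : Measurable F) {M : ℝ} (hM : ∀ x, F x ≤ M)
    {Z : ι → Ω → ℝ} (hZ : HasGaussianLaw (fun ω i => Z i ω) P) (hZ0 : ∀ i, ∫ ω, Z i ω ∂P = 0) :
    IsLogConcave (fun b => ∫ ω, F (b + fun i => Z i ω) ∂P) := by
  classical
  let _ := Fintype.ofFinite ι
  have := hZ.isProbabilityMeasure
  suffices H : ∀ (s : Finset ι) (Z : ι → Ω → ℝ), HasGaussianLaw (fun ω i => Z i ω) P →
      (∀ i, ∫ ω, Z i ω ∂P = 0) → (∀ i, i ∉ s → Z i =ᵐ[P] 0) →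
      IsLogConcave (fun b => ∫ ω, F (b + fun i => Z i ω) ∂P) from
    H Finset.univ Z hZ hZ0 (by simp)
  intro s
  induction s using Finset.induction_on with
  | empty =>
    intro Z hZ _ h
    have h' : ∀ᵐ ω ∂P, ∀ i, Z i ω = 0 := ae_all_iff.2 fun i => h i (by simp)
    have e : (fun b => ∫ ω, F (b + fun i => Z i ω) ∂P) = F := by
      ext b
      have : (fun ω => F (b + fun i => Z i ω)) =ᵐ[P] fun _ => F b := by
        filter_upwards [h'] with ω hω
        simp only [hω]
        congr 1
        ext i; simp
      rw [integral_congr_ae this]; simp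
    rw [e]; exact hF
  | insert i₀ s hi₀ ih =>
    intro Z hZ hZ0 h
    obtain ⟨c, h1, h2, h3, h4, h5⟩ := exists_gaussian_regression hZ hZ0 i₀
    have ih' := ih _ h1 h2 (fun i hi => by
      by_cases hii : i = i₀
      · subst hii; exact h4
      · exact h5 i (h i (by simp [hi, hii])))
    have hv := (hZ.eval i₀).map_eq_gaussianReal
    rw [hZ0] at hv
    set v := (Var[Z i₀; P]).toNNReal
    have hb : ∀ x, |F x| ≤ M := fun x => by rw [abs_of_nonneg (hF.1 x)]; exact hM x
    have e : (fun b => ∫ ω, F (b + fun i => Z i ω) ∂P) = fun b =>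
        ∫ x, (fun b' => ∫ ω, F (b' + fun i => Z i ω - c i * Z i₀ ω) ∂P) (b + x • c)
          ∂(gaussianReal 0 v) := by
      ext b
      rw [← hv]
      have := integral_indepFun_eq (hZ.eval i₀).aemeasurable h1.aemeasurable h3
        (G := fun x z => F (b + x • c + z)) (by simp only [Function.uncurry_def]; fun_prop)
        (M := M) (fun x z => hb _)
      rw [← this]
      refine integral_congr_ae (Eventually.of_forall fun ω => congrArg F ?_)
      ext i
      simp; ring
    rw [e]
    refine ih'.integral_gaussianReal (M := M) (fun x => ?_) c (fun b => ?_) v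
    · refine (integral_mono_of_nonneg (Eventually.of_forall fun ω => hF.1 _)
        (integrable_const M) (Eventually.of_forall fun ω => hM _)).trans ?_
      simp
    · have hm : Measurable (fun p : ℝ × (ι → ℝ) => F (b + p.1 • c + p.2)) := by fun_prop
      have := hm.stronglyMeasurable.integral_prod_right'
        (ν := P.map fun ω i => Z i ω - c i * Z i₀ ω)
      convert this.measurable using 2 with x
      exact (integral_map h1.aemeasurable
        (hm.comp measurable_prodMk_left).aestronglyMeasurable).symm

open ProbabilityTheory in
/-- A centered Gaussian vector is symmetric. -/
lemma map_neg_gaussian {Ω ι : Type*} [MeasurableSpace Ω] {P : Measure Ω} [Finite ι]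
    {Z : ι → Ω → ℝ} (hZ : HasGaussianLaw (fun ω i => Z i ω) P) (hZ0 : ∀ i, ∫ ω, Z i ω ∂P = 0) :
    P.map (fun ω i => -Z i ω) = P.map (fun ω i => Z i ω) := by
  let _ := Fintype.ofFinite ι
  have := hZ.isProbabilityMeasure
  have hN : HasGaussianLaw (fun ω i => -Z i ω) P := hZ.fun_neg
  have := Measure.isProbabilityMeasure_map hZ.aemeasurable
  have := Measure.isProbabilityMeasure_map hN.aemeasurable
  have hmean : ∫ ω, (fun i => Z i ω) ∂P = 0 := by
    ext i
    rw [eval_integral fun i => (hZ.eval i).integrable]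
    exact hZ0 i
  apply Measure.ext_of_charFunDual
  ext L
  have hL : ∫ ω, L (fun i => Z i ω) ∂P = 0 := by
    rw [L.integral_comp_comm hZ.integrable, hmean, map_zero]
  have hneg : (fun ω => L (fun i => -Z i ω)) = fun ω => -L (fun i => Z i ω) := by
    ext ω
    rw [← map_neg]; rfl
  rw [hZ.charFunDual_map_eq_fun, hN.charFunDual_map_eq_fun, hneg, integral_neg, hL, neg_zero,
    variance_fun_neg]

/-- The indicator of a convex set is log-concave. -/
lemma Convex.isLogConcave_indicator {E : Type*} [AddCommGroup E] [Module ℝ E] {K : Set E}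
    (hK : Convex ℝ K) : IsLogConcave (K.indicator fun _ => (1 : ℝ)) := by
  refine ⟨fun x => indicator_nonneg (fun _ _ => zero_le_one) x, fun x y a b ha hb hab => ?_⟩
  by_cases hx : x ∈ K
  · by_cases hy : y ∈ K
    · simp [hx, hy, hK hx hy ha.le hb.le hab]
    · simp [hy, Real.zero_rpow hb.ne', indicator_nonneg]
  · simp [hx, Real.zero_rpow ha.ne', indicator_nonneg]

/-- Chebyshev's association inequality for a symmetric interval and a function decreasing in the
absolute value. -/
lemma mul_integral_le_setIntegral {μ : Measure ℝ} [IsProbabilityMeasure μ] {g : ℝ → ℝ}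
    (hg : Integrable g μ) (hmono : ∀ x y, |x| ≤ |y| → g y ≤ g x) (a : ℝ) :
    μ.real {x | |x| ≤ a} * ∫ x, g x ∂μ ≤ ∫ x in {x | |x| ≤ a}, g x ∂μ := by
  rcases lt_or_ge a 0 with ha | ha
  · have : {x : ℝ | |x| ≤ a} = ∅ := by
      ext x; simp only [mem_ofPred_eq, mem_empty_iff_false, iff_false, not_le]
      exact ha.trans_le (abs_nonneg x)
    simp [this]
  set S := {x : ℝ | |x| ≤ a} with hS
  have hSm : MeasurableSet S := measurableSet_le (by fun_prop) (by fun_prop)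
  have h1 : g a * μ.real S ≤ ∫ x in S, g x ∂μ := by
    have : ∫ x in S, g a ∂μ ≤ ∫ x in S, g x ∂μ :=
      setIntegral_mono_on (by simp) hg.integrableOn hSm fun x hx =>
        hmono _ _ (by rw [abs_of_nonneg ha]; exact hx)
    simpa [mul_comm] using this
  have h2 : ∫ x in Sᶜ, g x ∂μ ≤ g a * μ.real Sᶜ := by
    have : ∫ x in Sᶜ, g x ∂μ ≤ ∫ x in Sᶜ, g a ∂μ :=
      setIntegral_mono_on hg.integrableOn (by simp) hSm.compl fun x hx =>
        hmono _ _ (by rw [abs_of_nonneg ha]; exact (not_le.1 (show ¬ |x| ≤ a from hx)).le)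
    simpa [mul_comm] using this
  have h3 := integral_add_compl hSm hg
  have h4 : μ.real Sᶜ = 1 - μ.real S := by rw [measureReal_compl hSm]; simp
  have h5 : 0 ≤ μ.real S := measureReal_nonneg
  have h6 : 0 ≤ 1 - μ.real S := h4 ▸ measureReal_nonneg
  rw [← h3]
  rw [h4] at h2
  nlinarith [mul_le_mul_of_nonneg_left h2 h5, mul_le_mul_of_nonneg_left h1 h6]

open ProbabilityTheory in
/-- **Khatri–Šidák inequality** for centered Gaussian vectors. -/
theorem khatri_sidak {Ω ι : Type*} [MeasurableSpace Ω] {P : Measure Ω} [Finite ι]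
    {X : ι → Ω → ℝ} (hX : HasGaussianLaw (fun ω i => X i ω) P) (hXm : ∀ i, Measurable (X i))
    (hX0 : ∀ i, ∫ ω, X i ω ∂P = 0) (a : ι → ℝ) (s : Finset ι) :
    ∏ i ∈ s, P.real {ω | |X i ω| ≤ a i} ≤ P.real {ω | ∀ i ∈ s, |X i ω| ≤ a i} := by
  classical
  let _ := Fintype.ofFinite ι
  have := hX.isProbabilityMeasure
  have hbox : ∀ s : Finset ι, MeasurableSet {x : ι → ℝ | ∀ i ∈ s, |x i| ≤ a i} := fun s => by
    have : {x : ι → ℝ | ∀ i ∈ s, |x i| ≤ a i} = ⋂ i ∈ s, {x | |x i| ≤ a i} := by ext; simp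
    rw [this]
    exact s.measurableSet_biInter fun i _ => measurableSet_le (by fun_prop) (by fun_prop)
  induction s using Finset.induction_on with
  | empty => simp
  | insert i₀ s hi₀ ih =>
    rw [Finset.prod_insert hi₀]
    obtain ⟨c, h1, h2, h3, -, -⟩ := exists_gaussian_regression hX hX0 i₀
    set Z : ι → Ω → ℝ := fun i ω => X i ω - c i * X i₀ ω with hZ
    set K : Set (ι → ℝ) := {x | ∀ i ∈ s, |x i| ≤ a i} with hK
    set F : (ι → ℝ) → ℝ := K.indicator fun _ => 1 with hF
    have hKconv : Convex ℝ K := by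
      have : K = ⋂ i ∈ s, (LinearMap.proj i : (ι → ℝ) →ₗ[ℝ] ℝ) ⁻¹' (Icc (-a i) (a i)) := by
        ext x; simp [hK, abs_le]
      rw [this]
      exact convex_iInter₂ fun i _ => (convex_Icc _ _).linear_preimage _
    have hFm : Measurable F := measurable_const.indicator (hbox s)
    have hFl : IsLogConcave F := hKconv.isLogConcave_indicator
    have hF1 : ∀ x, F x ≤ 1 := fun x => indicator_le_self' (by simp) x |>.trans le_rfl
    have hFabs : ∀ x, |F x| ≤ 1 := fun x => by rw [abs_of_nonneg (hFl.1 x)]; exact hF1 x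
    have hFeven : ∀ x, F (-x) = F x := fun x => by
      have hiff : -x ∈ K ↔ x ∈ K := by simp [hK]
      by_cases hx : x ∈ K
      · rw [hF, indicator_of_mem hx, indicator_of_mem (hiff.2 hx)]
      · rw [hF, indicator_of_notMem hx, indicator_of_notMem (mt hiff.1 hx)]
    set g : ℝ → ℝ := fun x => ∫ ω, F (x • c + fun i => Z i ω) ∂P with hg
    have hgl : IsLogConcave g := by
      have := (hFl.integral_gaussian hFm hF1 h1 h2).comp_add_linearMap 0
        (LinearMap.toSpanSingleton ℝ _ c)
      simpa [hg] using this
    have hgeven : ∀ x, g (-x) = g x := by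
      intro x
      have hmz : Measurable fun z : ι → ℝ => F (x • c + z) := by fun_prop
      calc g (-x) = ∫ ω, F (x • c + fun i => -Z i ω) ∂P := by
            refine integral_congr_ae (Eventually.of_forall fun ω => ?_)
            change F _ = F _
            rw [← hFeven]
            congr 1
            ext i; simp; ring
        _ = ∫ z, F (x • c + z) ∂(P.map fun ω i => -Z i ω) :=
            (integral_map (φ := fun ω i => -Z i ω) (HasGaussianLaw.fun_neg h1).aemeasurable
              hmz.aestronglyMeasurable).symm
        _ = g x := by
            rw [map_neg_gaussian h1 h2]
            exact integral_map h1.aemeasurable hmz.aestronglyMeasurable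
    have hgm : Measurable g := by
      have hm : Measurable (fun p : ℝ × (ι → ℝ) => F (p.1 • c + p.2)) := by fun_prop
      have := hm.stronglyMeasurable.integral_prod_right' (ν := P.map fun ω i => Z i ω)
      convert this.measurable using 2 with x
      exact (integral_map h1.aemeasurable
        (hm.comp measurable_prodMk_left).aestronglyMeasurable).symm
    have hg1 : ∀ x, g x ≤ 1 := fun x =>
      (integral_mono_of_nonneg (Eventually.of_forall fun ω => hFl.1 _)
        (integrable_const 1) (Eventually.of_forall fun ω => hF1 _)).trans (by simp)
    have := Measure.isProbabilityMeasure_map (hXm i₀).aemeasurable (μ := P)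
    have hgi : Integrable g (P.map (X i₀)) :=
      Integrable.of_bound hgm.aestronglyMeasurable 1 (Eventually.of_forall fun x => by
        rw [Real.norm_of_nonneg (hgl.1 x)]; exact hg1 x)
    have hSm : MeasurableSet {x : ℝ | |x| ≤ a i₀} := measurableSet_le (by fun_prop) (by fun_prop)
    have hXZ : ∀ ω, (X i₀ ω • c + fun i => Z i ω) = fun i => X i ω := fun ω => by
      ext i; simp [hZ]; ring
    have hXs : ∀ s : Finset ι, MeasurableSet {ω | ∀ i ∈ s, |X i ω| ≤ a i} := fun s =>
      (measurable_pi_lambda _ hXm) (hbox s)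
    have e1 : ∫ x, g x ∂(P.map (X i₀)) = P.real {ω | ∀ i ∈ s, |X i ω| ≤ a i} := by
      rw [← integral_indepFun_eq (hXm i₀).aemeasurable h1.aemeasurable h3
        (G := fun x z => F (x • c + z)) (by simp only [Function.uncurry_def]; fun_prop)
        (M := 1) (fun x z => hFabs _), ← integral_indicator_one (hXs s)]
      refine integral_congr_ae (Eventually.of_forall fun ω => ?_)
      change F (X i₀ ω • c + fun i => Z i ω) = _
      rw [hXZ]
      rfl
    have e2 : ∫ x in {x : ℝ | |x| ≤ a i₀}, g x ∂(P.map (X i₀)) =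
        P.real {ω | ∀ i ∈ insert i₀ s, |X i ω| ≤ a i} := by
      have := integral_indepFun_eq (hXm i₀).aemeasurable h1.aemeasurable h3
        (G := fun x z => {x : ℝ | |x| ≤ a i₀}.indicator (fun _ => (1 : ℝ)) x * F (x • c + z))
        (by
          simp only [Function.uncurry_def]
          exact ((measurable_const.indicator hSm).comp measurable_fst).mul (by fun_prop))
        (M := 1) (fun x z => by
          rw [abs_mul]
          refine mul_le_one₀ ?_ (abs_nonneg _) (hFabs _)
          rw [indicator]; split_ifs <;> simp)
      rw [← integral_indicator hSm, ← integral_indicator_one (hXs (insert i₀ s))]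
      have e : ∀ x, {x : ℝ | |x| ≤ a i₀}.indicator g x = ∫ ω, {x : ℝ | |x| ≤ a i₀}.indicator
          (fun _ => (1 : ℝ)) x * F (x • c + fun i => Z i ω) ∂P := by
        intro x
        rw [integral_const_mul]
        by_cases hx : x ∈ {x : ℝ | |x| ≤ a i₀}
        · rw [indicator_of_mem hx, indicator_of_mem hx, one_mul]
        · rw [indicator_of_notMem hx, indicator_of_notMem hx, zero_mul]
      simp_rw [e]
      rw [← this]
      refine integral_congr_ae (Eventually.of_forall fun ω => ?_)
      change {x : ℝ | |x| ≤ a i₀}.indicator (fun _ => (1 : ℝ)) (X i₀ ω) *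
        F (X i₀ ω • c + fun i => Z i ω) = _
      rw [hXZ ω, hF]
      by_cases hx : |X i₀ ω| ≤ a i₀ <;> by_cases hy : ∀ i ∈ s, |X i ω| ≤ a i <;>
        simp [indicator, hx, hy, hK]
    have e3 : (P.map (X i₀)).real {x | |x| ≤ a i₀} = P.real {ω | |X i₀ ω| ≤ a i₀} := by
      rw [map_measureReal_apply (hXm i₀) hSm]; rfl
    have key := mul_integral_le_setIntegral hgi (fun x y hxy => hgl.le_of_even hgeven hxy) (a i₀)
    rw [e1, e2, e3] at key
    exact (mul_le_mul_of_nonneg_left ih measureReal_nonneg).trans key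

open ProbabilityTheory in
/-- Small-ball estimate for the standard normal law with an arbitrary power `q > 0`. -/
lemma exists_exp_neg_rpow_le_gaussianReal_one {q : ℝ} (hq : 0 < q) :
    ∃ C > 0, ∀ r > 0, Real.exp (-(C * r ^ (-q))) ≤ (gaussianReal 0 1).real {x | |x| ≤ r} := by
  set γ := gaussianReal 0 1 with hγ
  have hInt : Integrable (fun x : ℝ => |x| ^ q) γ := by
    have := (memLp_id_gaussianReal (μ := 0) (v := 1) q.toNNReal).integrable_norm_rpow'
    simpa [hq.le] using this
  set m := ∫ x, |x| ^ q ∂γ + 1 with hm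
  have hm0 : 0 < m := by
    have : 0 ≤ ∫ x, |x| ^ q ∂γ := integral_nonneg fun x => by positivity
    linarith
  set r₀ := (2 * m) ^ q⁻¹ with hr₀
  have hr₀pos : 0 < r₀ := by positivity
  have hr₀q : r₀ ^ q = 2 * m := by
    rw [hr₀, ← Real.rpow_mul (by positivity), inv_mul_cancel₀ hq.ne', Real.rpow_one]
  set c := gaussianPDFReal 0 1 r₀ with hc
  have hcpos : 0 < c := gaussianPDFReal_pos _ _ _ one_ne_zero
  have hmeas : ∀ r : ℝ, MeasurableSet {x : ℝ | |x| ≤ r} := fun r =>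
    measurableSet_le (by fun_prop) (by fun_prop)
  refine ⟨2 * m + |Real.log c| * r₀ ^ q + 1 / q, by positivity, fun r hr => ?_⟩
  have hrq : 0 < r ^ (-q) := by positivity
  rcases le_or_gt r₀ r with h | h
  · have hx : m * r ^ (-q) ≤ 1 / 2 := by
      have : r₀ ^ q ≤ r ^ q := Real.rpow_le_rpow hr₀pos.le h hq.le
      rw [Real.rpow_neg hr.le, ← div_eq_mul_inv, div_le_iff₀ (by positivity)]
      linarith
    have hmarkov : γ.real {x | |x| ≤ r}ᶜ ≤ m * r ^ (-q) := by
      have h1 := mul_meas_ge_le_integral_of_nonneg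
        (Eventually.of_forall fun x : ℝ => (by positivity : 0 ≤ |x| ^ q)) hInt (r ^ q)
      have h2 : γ.real {x | |x| ≤ r}ᶜ ≤ γ.real {x | r ^ q ≤ |x| ^ q} := by
        refine measureReal_mono fun x hx => ?_
        exact Real.rpow_le_rpow hr.le (not_le.1 (show ¬ |x| ≤ r from hx)).le hq.le
      rw [Real.rpow_neg hr.le, ← div_eq_mul_inv, le_div_iff₀ (by positivity)]
      nlinarith [Real.rpow_pos_of_pos hr q]
    rw [measureReal_compl (hmeas r), probReal_univ] at hmarkov
    set x := m * r ^ (-q)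
    have hexp : Real.exp (-(2 * x)) ≤ 1 - x := by
      have hxpos : 0 < x := by positivity
      have h1 : 1 + 2 * x ≤ Real.exp (2 * x) := by linarith [Real.add_one_le_exp (2 * x)]
      rw [Real.exp_neg, inv_le_comm₀ (Real.exp_pos _) (by linarith)]
      refine le_trans ?_ h1
      rw [inv_le_iff_one_le_mul₀ (by linarith)]
      nlinarith
    refine le_trans (Real.exp_le_exp.2 ?_) (hexp.trans (by linarith))
    have : 0 ≤ (|Real.log c| * r₀ ^ q + 1 / q) * r ^ (-q) := by positivity
    simp only [x]
    nlinarith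
  · have hlow : c * r ≤ γ.real {x | |x| ≤ r} := by
      have h1 : γ.real {x | |x| ≤ r} = ∫ x in {x | |x| ≤ r}, gaussianPDFReal 0 1 x := by
        rw [measureReal_def, hγ, gaussianReal_apply_eq_integral _ one_ne_zero,
          ENNReal.toReal_ofReal (integral_nonneg fun x => gaussianPDFReal_nonneg _ _ _)]
      have hI : {x : ℝ | |x| ≤ r} = Icc (-r) r := by ext x; simp [abs_le]
      have h2 : ∫ x in Icc (-r) r, c ≤ ∫ x in Icc (-r) r, gaussianPDFReal 0 1 x := by
        refine setIntegral_mono_on (by simp) (integrable_gaussianPDFReal 0 1).integrableOn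
          measurableSet_Icc fun x hx => ?_
        rw [hc, gaussianPDFReal_def]
        have : x ^ 2 ≤ r₀ ^ 2 := sq_le_sq' (by linarith [hx.1]) (by linarith [hx.2])
        simp only [sub_zero]
        gcongr
      rw [h1, hI]
      refine le_trans ?_ h2
      simp
      rw [max_eq_left (by linarith)]
      nlinarith
    refine le_trans ?_ hlow
    rw [← Real.exp_log (mul_pos hcpos hr), Real.exp_le_exp, Real.log_mul hcpos.ne' hr.ne']
    have h1 : Real.log r⁻¹ ≤ r⁻¹ ^ q / q := Real.log_le_rpow_div (by positivity) hq
    rw [Real.log_inv, Real.inv_rpow hr.le, ← Real.rpow_neg hr.le] at h1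
    have h2 : 1 ≤ r₀ ^ q * r ^ (-q) := by
      rw [Real.rpow_neg hr.le, ← div_eq_mul_inv, one_le_div (by positivity)]
      exact Real.rpow_le_rpow hr.le h.le hq.le
    have h3 : -Real.log c ≤ |Real.log c| * (r₀ ^ q * r ^ (-q)) :=
      (neg_le_abs _).trans (le_mul_of_one_le_right (abs_nonneg _) h2)
    have h4 : 0 ≤ 2 * m * r ^ (-q) := by positivity
    have h5 : r ^ (-q) / q = 1 / q * r ^ (-q) := by ring
    rw [h5] at h1
    nlinarith

open ProbabilityTheory in
/-- Small-ball estimate for centered normal laws with an arbitrary power `q > 0`. -/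
lemma exists_exp_neg_rpow_le_gaussianReal {q : ℝ} (hq : 0 < q) :
    ∃ C > 0, ∀ r > 0, ∀ (v : NNReal) (τ : ℝ), Real.sqrt v ≤ τ →
      Real.exp (-(C * r ^ (-q))) ≤ (gaussianReal 0 v).real {x | |x| ≤ r * τ} := by
  obtain ⟨C, hC, h⟩ := exists_exp_neg_rpow_le_gaussianReal_one hq
  refine ⟨C, hC, fun r hr v τ hτ => (h r hr).trans ?_⟩
  have hv : (gaussianReal 0 1).map (fun x => Real.sqrt v * x) = gaussianReal 0 v := by
    rw [gaussianReal_map_const_mul]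
    congr 1
    · simp
    · ext; simp
  rw [← hv, map_measureReal_apply (by fun_prop) (measurableSet_le (by fun_prop) (by fun_prop))]
  refine measureReal_mono fun x (hx : |x| ≤ r) => ?_
  change |Real.sqrt v * x| ≤ r * τ
  rw [abs_mul, abs_of_nonneg (Real.sqrt_nonneg _), mul_comm]
  exact mul_le_mul hx hτ (Real.sqrt_nonneg _) hr.le

/-- Dyadic chaining from level `j + d` down to level `j`. -/
lemma abs_sub_dyadic_floor_le {u : ℝ → ℝ} {a : ℕ → ℝ}
    (hu : ∀ k i : ℕ, i < 2 ^ k → |u ((i + 1 : ℝ) / 2 ^ k) - u (i / 2 ^ k)| ≤ a k)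
    (ha : ∀ k, 0 ≤ a k) (j d : ℕ) : ∀ p : ℕ, p ≤ 2 ^ (j + d) →
    |u (p / 2 ^ (j + d)) - u ((p / 2 ^ d : ℕ) / 2 ^ j)| ≤ ∑ k ∈ Finset.range d, a (j + 1 + k) := by
  induction d with
  | zero => intro p _; simp
  | succ d ih =>
    intro p hp
    have hp2 : p / 2 ≤ 2 ^ (j + d) := by
      rw [← add_assoc, pow_succ] at hp; omega
    have h1 := ih (p / 2) hp2
    have h2 : p / 2 / 2 ^ d = p / 2 ^ (d + 1) := by
      rw [Nat.div_div_eq_div_mul, pow_succ, mul_comm]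
    rw [h2] at h1
    have h3 : |u (p / 2 ^ (j + (d + 1))) - u ((p / 2 : ℕ) / 2 ^ (j + d))| ≤ a (j + 1 + d) := by
      have e : ((p / 2 : ℕ) : ℝ) / 2 ^ (j + d) = ((2 * (p / 2) : ℕ) : ℝ) / 2 ^ (j + 1 + d) := by
        push_cast
        rw [show j + 1 + d = j + d + 1 by ring, pow_succ]
        field_simp
      rw [e, show j + (d + 1) = j + 1 + d by ring]
      rcases Nat.even_or_odd' p with ⟨i, rfl | rfl⟩
      · rw [Nat.mul_div_cancel_left _ (by norm_num)]
        simpa using ha _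
      · rw [show (2 * i + 1) / 2 = i by omega]
        have := hu (j + 1 + d) (2 * i) (by
          rw [show j + 1 + d = j + (d + 1) by ring]; omega)
        push_cast at this ⊢
        exact this
    rw [Finset.sum_range_succ]
    have := abs_sub_le (u (p / 2 ^ (j + (d + 1)))) (u ((p / 2 : ℕ) / 2 ^ (j + d)))
      (u ((p / 2 ^ (d + 1) : ℕ) / 2 ^ j))
    linarith

/-- Dyadic chaining for two points at distance at most twice the mesh of level `j`. -/
lemma abs_sub_dyadic_le {u : ℝ → ℝ} {a : ℕ → ℝ}
    (hu : ∀ k i : ℕ, i < 2 ^ k → |u ((i + 1 : ℝ) / 2 ^ k) - u (i / 2 ^ k)| ≤ a k)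
    (ha : ∀ k, 0 ≤ a k) {j d p q : ℕ} (hpq : p ≤ q) (hq : q ≤ 2 ^ (j + d))
    (hqp : q ≤ p + 2 * 2 ^ d) :
    |u (q / 2 ^ (j + d)) - u (p / 2 ^ (j + d))| ≤
      2 * ∑ k ∈ Finset.range (d + 1), a (j + k) := by
  have h1 := abs_sub_dyadic_floor_le hu ha j d q hq
  have h2 := abs_sub_dyadic_floor_le hu ha j d p (hpq.trans hq)
  have hle : p / 2 ^ d ≤ q / 2 ^ d := Nat.div_le_div_right hpq
  have hge : q / 2 ^ d ≤ p / 2 ^ d + 2 := by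
    calc q / 2 ^ d ≤ (p + 2 * 2 ^ d) / 2 ^ d := Nat.div_le_div_right hqp
      _ = p / 2 ^ d + 2 := Nat.add_mul_div_right _ _ (by positivity)
  have hQ : q / 2 ^ d ≤ 2 ^ j := by
    apply Nat.div_le_of_le_mul
    rwa [← pow_add, add_comm]
  generalize p / 2 ^ d = x at *
  generalize q / 2 ^ d = y at *
  have h3 : |u (y / 2 ^ j) - u (x / 2 ^ j)| ≤ 2 * a j := by
    have haj := ha j
    obtain rfl | rfl | rfl : y = x ∨ y = x + 1 ∨ y = x + 2 := by omega
    · simpa using haj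
    · have := hu j x (by omega)
      push_cast
      linarith
    · have e1 := hu j x (by omega)
      have e2 := hu j (x + 1) (by omega)
      push_cast at e2 ⊢
      rw [add_assoc, one_add_one_eq_two] at e2
      have := abs_sub_le (u ((x + 2) / 2 ^ j)) (u ((x + 1) / 2 ^ j)) (u (x / 2 ^ j))
      linarith
  have h4 : ∑ k ∈ Finset.range (d + 1), a (j + k) =
      ∑ k ∈ Finset.range d, a (j + 1 + k) + a j := by
    rw [Finset.sum_range_succ']
    simp only [add_zero, add_comm, add_left_comm]
  rw [abs_le] at *
  constructor <;> linarith [h1.1, h1.2, h2.1, h2.2, h3.1, h3.2]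

/-- Modulus of continuity on the dyadic points obtained from bounds on dyadic increments. -/
lemma abs_sub_le_of_dyadic {u : ℝ → ℝ} {a : ℕ → ℝ}
    (hu : ∀ k i : ℕ, i < 2 ^ k → |u ((i + 1 : ℝ) / 2 ^ k) - u (i / 2 ^ k)| ≤ a k)
    (ha : ∀ k, 0 ≤ a k) {g : ℝ → ℝ} (hg : MonotoneOn g (Icc 0 1)) {ε : ℝ} (hε : ε ∈ Ioc (0 : ℝ) 1)
    {n : ℕ} (hn : ε ≤ (1 / 2) ^ n)
    (hcoarse : ∀ d, 2 * ∑ k ∈ Finset.range d, a k ≤ g ε)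
    (hfine : ∀ m ≥ n, ∀ d, 2 * ∑ k ∈ Finset.range d, a (m + 1 + k) ≤ g ((1 / 2) ^ (m + 1)))
    {L p q : ℕ} (hpq : p < q) (hq : q ≤ 2 ^ L) :
    |u (q / 2 ^ L) - u (p / 2 ^ L)| ≤ g (q / 2 ^ L - p / 2 ^ L) := by
  have hpq' : (p : ℝ) < q := by exact_mod_cast hpq
  have hq' : (q : ℝ) ≤ 2 ^ L := by exact_mod_cast hq
  have h2L : (0 : ℝ) < 2 ^ L := by positivity
  set h : ℝ := q / 2 ^ L - p / 2 ^ L with hh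
  have hh' : h = (q - p) / 2 ^ L := by rw [hh]; ring
  have hpos : 0 < h := by rw [hh']; exact div_pos (by linarith) h2L
  have hle : h ≤ 1 := by
    rw [hh', div_le_one h2L]
    linarith [(Nat.cast_nonneg p : (0 : ℝ) ≤ p)]
  rcases le_or_gt ε h with hεh | hεh
  · have := abs_sub_dyadic_le hu ha (j := 0) (d := L) hpq.le (by simpa using hq) (by omega)
    simp only [zero_add] at this
    exact this.trans ((hcoarse _).trans (hg ⟨hε.1.le, hε.2⟩ ⟨hpos.le, hle⟩ hεh))
  · obtain ⟨m, hm1, hm2⟩ := exists_nat_pow_near_of_lt_one hpos hle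
      (by norm_num : (0 : ℝ) < 1 / 2) (by norm_num)
    have hmn : n ≤ m := by
      have : ((1 : ℝ) / 2) ^ (m + 1) < (1 / 2) ^ n := hm1.trans (hεh.trans_le hn)
      have := (pow_lt_pow_iff_right_of_lt_one₀ (by norm_num) (by norm_num)).1 this
      omega
    have e : ∀ x : ℕ, (x : ℝ) / 2 ^ L = ((x * 2 ^ (m + 1) : ℕ) : ℝ) / 2 ^ (m + 1 + L) := by
      intro x
      push_cast
      rw [pow_add]
      field_simp
      ring
    have hclose : q * 2 ^ (m + 1) ≤ p * 2 ^ (m + 1) + 2 * 2 ^ L := by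
      have : ((q * 2 ^ (m + 1) : ℕ) : ℝ) ≤ (p * 2 ^ (m + 1) + 2 * 2 ^ L : ℕ) := by
        push_cast
        rw [hh', div_le_iff₀ h2L, one_div, inv_pow, inv_mul_eq_div, le_div_iff₀ (by positivity)]
          at hm2
        rw [pow_succ]
        linarith
      exact_mod_cast this
    have := abs_sub_dyadic_le hu ha (j := m + 1) (d := L)
      (Nat.mul_le_mul_right (2 ^ (m + 1)) hpq.le)
      (by rw [pow_add 2 (m + 1), mul_comm]; exact Nat.mul_le_mul_left _ hq) hclose
    rw [← e, ← e] at this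
    refine this.trans ((hfine m hmn _).trans (hg ⟨by positivity, ?_⟩ ⟨hpos.le, hle⟩ hm1.le))
    exact pow_le_one₀ (by norm_num) (by norm_num)

/-- A two-sided geometric sum. -/
lemma sum_pow_dist_le {ρ : ℝ} (h0 : 0 ≤ ρ) (h1 : ρ < 1) (n L : ℕ) :
    ∑ k ∈ Finset.range L, ρ ^ ((n - k) + (k - n)) ≤ 2 * (1 - ρ)⁻¹ := by
  have hgeom : ∀ d, ∑ k ∈ Finset.range d, ρ ^ k ≤ (1 - ρ)⁻¹ := fun d => by
    rw [← tsum_geometric_of_lt_one h0 h1]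
    exact (summable_geometric_of_lt_one h0 h1).sum_le_tsum _ fun _ _ => by positivity
  calc ∑ k ∈ Finset.range L, ρ ^ ((n - k) + (k - n))
      ≤ ∑ k ∈ Finset.range (n + L), ρ ^ ((n - k) + (k - n)) :=
        Finset.sum_le_sum_of_subset_of_nonneg (by simp) fun _ _ _ => by positivity
    _ = ∑ k ∈ Finset.range n, ρ ^ ((n - k) + (k - n)) + ∑ k ∈ Finset.range L, ρ ^ k := by
        rw [Finset.sum_range_add]
        congr 1
        exact Finset.sum_congr rfl fun k _ => by congr 1; omega
    _ ≤ ∑ k ∈ Finset.range n, ρ ^ k + ∑ k ∈ Finset.range L, ρ ^ k := by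
        gcongr ?_ + _
        rw [← Finset.sum_range_reflect]
        refine Finset.sum_le_sum fun k hk => ?_
        have := Finset.mem_range.1 hk
        exact pow_le_pow_of_le_one h0 h1.le (by omega)
    _ ≤ 2 * (1 - ρ)⁻¹ := by linarith [hgeom n, hgeom L]

/-- The relative size, at dyadic level `k`, of the increments allowed in the small-ball event
attached to the scale `2 ^ (-n)`. -/
def levelRadius (δ θ : ℝ) (n k : ℕ) : ℝ := δ * (4 / 9) ^ (n - k) * θ ^ (k - n)

lemma levelRadius_pos {δ θ : ℝ} (hδ : 0 < δ) (hθ : 0 < θ) (n k : ℕ) : 0 < levelRadius δ θ n k := by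
  unfold levelRadius; positivity

/-- Gaussian cost of the level radii. -/
lemma exists_exp_neg_le_gaussianReal_levelRadius {β δ : ℝ} (hβ : 0 < β) (hδ : 0 < δ) :
    ∃ D > 0, ∀ (n k : ℕ) (v : NNReal) (τ : ℝ), Real.sqrt v ≤ τ →
      Real.exp (-(D * (2 ^ n / 2 ^ k) * (3 / 4) ^ ((n - k) + (k - n)))) ≤
        (ProbabilityTheory.gaussianReal 0 v).real
          {x | |x| ≤ levelRadius δ (2 ^ (β / 2)) n k * τ} := by
  obtain ⟨C₁, hC₁, h₁⟩ := exists_exp_neg_rpow_le_gaussianReal (q := 4 / β) (by positivity)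
  obtain ⟨C₂, hC₂, h₂⟩ := exists_exp_neg_rpow_le_gaussianReal (q := 1 / 2) (by positivity)
  set A := C₁ * δ ^ (-(4 / β)) with hA
  set B := C₂ * δ ^ (-(1 / 2) : ℝ) with hB
  have hA0 : 0 < A := by positivity
  have hB0 : 0 < B := by positivity
  refine ⟨A + B, by positivity, fun n k v τ hτ => ?_⟩
  have hr := levelRadius_pos hδ (by positivity : (0 : ℝ) < 2 ^ (β / 2)) n k
  rcases le_total n k with hnk | hnk
  · refine le_trans (Real.exp_le_exp.2 (neg_le_neg ?_)) (h₁ _ hr v τ hτ)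
    obtain ⟨i, rfl⟩ := Nat.exists_eq_add_of_le hnk
    have e : C₁ * levelRadius δ (2 ^ (β / 2)) n (n + i) ^ (-(4 / β)) = A * (1 / 4) ^ i := by
      simp only [levelRadius, Nat.sub_eq_zero_of_le hnk, pow_zero, mul_one, Nat.add_sub_cancel_left]
      have h4 : ((2 : ℝ) ^ (β / 2)) ^ (-(4 / β)) = 1 / 4 := by
        rw [← Real.rpow_mul (by norm_num), show β / 2 * (-(4 / β)) = ((-2 : ℤ) : ℝ) by
          field_simp; norm_num, Real.rpow_intCast]
        norm_num
      rw [Real.mul_rpow hδ.le (by positivity), ← Real.rpow_pow_comm (by positivity), h4, hA,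
        mul_assoc]
    rw [e]
    have e2 : (A + B) * (2 ^ n / 2 ^ (n + i)) * (3 / 4) ^ (n - (n + i) + (n + i - n)) =
        (A + B) * (3 / 8) ^ i := by
      rw [Nat.sub_eq_zero_of_le hnk, Nat.add_sub_cancel_left, zero_add, pow_add,
        div_mul_cancel_left₀ (by positivity), mul_assoc, ← inv_pow, ← mul_pow]
      norm_num
    rw [e2]
    gcongr ?_ * ?_ ^ i
    · linarith
    · norm_num
  · refine le_trans (Real.exp_le_exp.2 (neg_le_neg ?_)) (h₂ _ hr v τ hτ)
    obtain ⟨i, rfl⟩ := Nat.exists_eq_add_of_le hnk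
    have e : C₂ * levelRadius δ (2 ^ (β / 2)) (k + i) k ^ (-(1 / 2) : ℝ) = B * (3 / 2) ^ i := by
      simp only [levelRadius, Nat.sub_eq_zero_of_le hnk, pow_zero, mul_one, Nat.add_sub_cancel_left]
      have h4 : (4 / 9 : ℝ) ^ (-(1 / 2) : ℝ) = 3 / 2 := by
        rw [show (4 / 9 : ℝ) = (2 / 3) ^ (2 : ℝ) by norm_num, ← Real.rpow_mul (by norm_num)]
        norm_num [Real.rpow_neg_one]
      rw [Real.mul_rpow hδ.le (by positivity), ← Real.rpow_pow_comm (by positivity), h4, hB,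
        mul_assoc]
    rw [e]
    have e2 : (A + B) * (2 ^ (k + i) / 2 ^ k) * (3 / 4) ^ (k + i - k + (k - (k + i))) =
        (A + B) * (3 / 2) ^ i := by
      rw [Nat.sub_eq_zero_of_le hnk, Nat.add_sub_cancel_left, add_zero, pow_add,
        mul_div_cancel_left₀ _ (by positivity), mul_assoc, ← mul_pow]
      norm_num
    rw [e2]
    gcongr
    linarith

/-- Finer dyadic levels have uniformly bounded geometric contributions. -/
lemma sum_fine_le {β δ c ε : ℝ} {σ f : ℝ → ℝ} {n : ℕ} (hβ : 0 < β) (hδ : 0 < δ) (hc : 0 < c)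
    (hσ : ∀ x ∈ Icc (0 : ℝ) 1, 0 ≤ σ x)
    (hfmono : MonotoneOn f (Icc 0 1)) (hfpos : ∀ x ∈ Ioc (0 : ℝ) 1, 0 < f x)
    (hmono : MonotoneOn (fun x => σ x / (x ^ β * f x)) (Ioc 0 1)) (hε : ε ∈ Ioc (0 : ℝ) 1)
    (hn : (1 / 2) ^ (n + 1) < ε) {m : ℕ} (hm : n ≤ m) (d : ℕ) :
    ∑ k ∈ Finset.range d, levelRadius δ (2 ^ (β / 2)) n (m + 1 + k) * (σ ((1 / 2) ^ (m + 1 + k)) / c)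
      ≤ δ / c * (2 ^ β * (1 - (2 ^ (β / 2))⁻¹)⁻¹) * (σ ε / f ε * f ((1 / 2) ^ (m + 1))) := by
  set θ : ℝ := 2 ^ (β / 2) with hθ
  have hθ1 : 1 < θ := Real.one_lt_rpow (by norm_num) (by positivity)
  have hθ0 : 0 < θ := by linarith
  have hθ2 : (2 : ℝ) ^ β = θ ^ 2 := by
    rw [hθ, ← Real.rpow_natCast, ← Real.rpow_mul (by norm_num)]; congr 1; push_cast; ring
  set K := σ ε / f ε with hK
  have hfε := hfpos ε hε
  have hK0 : 0 ≤ K := div_nonneg (hσ ε ⟨hε.1.le, hε.2⟩) hfε.le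
  have hx : ∀ j, ((1 : ℝ) / 2) ^ j ∈ Ioc (0 : ℝ) 1 := fun j =>
    ⟨by positivity, pow_le_one₀ (by norm_num) (by norm_num)⟩
  have hterm : ∀ k, levelRadius δ θ n (m + 1 + k) * (σ ((1 / 2) ^ (m + 1 + k)) / c) ≤
      δ / c * θ ^ 2 * (K * f ((1 / 2) ^ (m + 1))) * θ⁻¹ ^ k := by
    intro k
    obtain ⟨i, rfl⟩ := Nat.exists_eq_add_of_le hm
    set x : ℝ := (1 / 2) ^ (n + i + 1 + k) with hxdef
    have hx0 := hx (n + i + 1 + k)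
    rw [← hxdef] at hx0
    have hxε : x ≤ (1 / 2) ^ (i + k) * ε := by
      rw [hxdef, show n + i + 1 + k = (i + k) + (n + 1) by ring, pow_add]
      gcongr
    have hxε' : x ≤ ε := hxε.trans (mul_le_of_le_one_left hε.1.le (hx _).2)
    have h1 : σ x ≤ K * f ((1 / 2) ^ (n + i + 1)) * θ⁻¹ ^ (2 * (i + k)) := by
      have h := hmono hx0 hε hxε'
      have hfx := hfpos x hx0
      have hxβ : 0 < x ^ β := Real.rpow_pos_of_pos hx0.1 _
      have hεβ : 0 < ε ^ β := Real.rpow_pos_of_pos hε.1 _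
      simp only at h
      rw [div_le_iff₀ (by positivity)] at h
      have hxb : x ^ β ≤ θ⁻¹ ^ (2 * (i + k)) * ε ^ β := by
        have : ((1 / 2 : ℝ) ^ (i + k)) ^ β = θ⁻¹ ^ (2 * (i + k)) := by
          rw [pow_mul, inv_pow, ← hθ2, ← Real.rpow_natCast, ← Real.rpow_mul (by norm_num),
            mul_comm, Real.rpow_mul (by norm_num), Real.rpow_natCast]
          congr 1
          rw [one_div, Real.inv_rpow (by norm_num)]
        rw [← this, ← Real.mul_rpow (by positivity) hε.1.le]
        exact Real.rpow_le_rpow hx0.1.le hxε hβ.le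
      have hff : f x ≤ f ((1 / 2) ^ (n + i + 1)) :=
        hfmono ⟨hx0.1.le, hx0.2⟩ ⟨(hx _).1.le, (hx _).2⟩
          (pow_le_pow_of_le_one (by norm_num) (by norm_num) (by omega))
      calc σ x ≤ σ ε / (ε ^ β * f ε) * (x ^ β * f x) := h
        _ = K * f x * (x ^ β / ε ^ β) := by rw [hK]; field_simp
        _ ≤ K * f ((1 / 2) ^ (n + i + 1)) * θ⁻¹ ^ (2 * (i + k)) := by
          have hfy := hfpos _ (hx (n + i + 1))
          gcongr
          rwa [div_le_iff₀ hεβ]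
    have hfy := hfpos _ (hx (n + i + 1))
    have hlev : levelRadius δ θ n (n + i + 1 + k) = δ * θ ^ (i + 1 + k) := by
      rw [levelRadius, Nat.sub_eq_zero_of_le (by omega), pow_zero, mul_one]
      congr 2; omega
    rw [hlev]
    calc δ * θ ^ (i + 1 + k) * (σ x / c)
        ≤ δ * θ ^ (i + 1 + k) * (K * f ((1 / 2) ^ (n + i + 1)) * θ⁻¹ ^ (2 * (i + k)) / c) := by
          gcongr
      _ = δ / c * θ * (K * f ((1 / 2) ^ (n + i + 1))) * θ⁻¹ ^ (i + k) := by
          rw [show i + 1 + k = (i + k) + 1 by ring, two_mul, pow_add θ⁻¹, pow_succ]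
          simp only [inv_pow]
          field_simp
      _ ≤ δ / c * θ ^ 2 * (K * f ((1 / 2) ^ (n + i + 1))) * θ⁻¹ ^ k := by
          have : θ ≤ θ ^ 2 := by nlinarith
          gcongr ?_ * ?_
          · gcongr
          · exact pow_le_pow_of_le_one (by positivity) (inv_le_one_of_one_le₀ hθ1.le) (by omega)
  refine (Finset.sum_le_sum fun k _ => hterm k).trans ?_
  rw [← Finset.mul_sum, hθ2]
  have hgeom : ∑ k ∈ Finset.range d, θ⁻¹ ^ k ≤ (1 - θ⁻¹)⁻¹ := by
    have h1 : θ⁻¹ < 1 := inv_lt_one_of_one_lt₀ hθ1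
    rw [← tsum_geometric_of_lt_one (by positivity) h1]
    exact (summable_geometric_of_lt_one (by positivity) h1).sum_le_tsum _
      fun _ _ => by positivity
  have hfy := hfpos _ (hx (m + 1))
  calc _ ≤ δ / c * θ ^ 2 * (K * f ((1 / 2) ^ (m + 1))) * (1 - θ⁻¹)⁻¹ := by gcongr
    _ = _ := by ring

/-- Coarser dyadic levels are controlled by concavity. -/
lemma sum_coarse_le {δ θ c ε : ℝ} {σ : ℝ → ℝ} {n : ℕ} (hδ : 0 < δ) (hc : 0 < c)
    (hσ : ∀ x ∈ Icc (0 : ℝ) 1, 0 ≤ σ x) (hconc : ConcaveOn ℝ (Icc 0 1) σ)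
    (hε : ε ∈ Ioc (0 : ℝ) 1) (hn : (1 / 2) ^ (n + 1) < ε) (hn' : ε ≤ (1 / 2) ^ n) :
    ∑ k ∈ Finset.range (n + 1), levelRadius δ θ n k * (σ ((1 / 2) ^ k) / c)
      ≤ δ / c * 18 * σ ε := by
  have hσε := hσ ε ⟨hε.1.le, hε.2⟩
  have hterm : ∀ k ∈ Finset.range (n + 1), levelRadius δ θ n k * (σ ((1 / 2) ^ k) / c) ≤
      δ / c * 2 * σ ε * (8 / 9) ^ (n - k) := by
    intro k hk
    obtain ⟨i, rfl⟩ := Nat.exists_eq_add_of_le (Nat.lt_succ_iff.1 (Finset.mem_range.1 hk))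
    set x : ℝ := (1 / 2) ^ k with hx
    have hx0 : 0 < x := by positivity
    have hx1 : x ≤ 1 := pow_le_one₀ (by norm_num) (by norm_num)
    have hεx : ε ≤ x := hn'.trans (pow_le_pow_of_le_one (by norm_num) (by norm_num) (by omega))
    have h1 : ε / x * σ x ≤ σ ε := by
      have := hconc.2 (show x ∈ Icc (0 : ℝ) 1 from ⟨hx0.le, hx1⟩)
        (show (0 : ℝ) ∈ Icc (0 : ℝ) 1 from ⟨le_rfl, zero_le_one⟩) (div_nonneg hε.1.le hx0.le)
        (sub_nonneg.2 ((div_le_one hx0).2 hεx)) (by ring)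
      simp only [smul_eq_mul, mul_zero, add_zero, div_mul_cancel₀ _ hx0.ne'] at this
      have h0 := mul_nonneg (sub_nonneg.2 ((div_le_one hx0).2 hεx))
        (hσ 0 ⟨le_rfl, zero_le_one⟩)
      linarith
    have h2 : (1 / 2 : ℝ) ^ (i + 1) ≤ ε / x := by
      rw [le_div_iff₀ hx0, hx, ← pow_add, show i + 1 + k = k + i + 1 by ring]
      exact hn.le
    have hσx := hσ x ⟨hx0.le, hx1⟩
    have h3 : σ x ≤ 2 ^ (i + 1) * σ ε := by
      have := (mul_le_mul_of_nonneg_right h2 hσx).trans h1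
      rw [one_div, inv_pow, inv_mul_le_iff₀ (by positivity)] at this
      exact this
    rw [levelRadius, Nat.sub_eq_zero_of_le (Nat.le_add_right k i), pow_zero, mul_one,
      Nat.add_sub_cancel_left]
    calc δ * (4 / 9) ^ i * (σ x / c) ≤ δ * (4 / 9) ^ i * (2 ^ (i + 1) * σ ε / c) := by gcongr
      _ = δ / c * 2 * σ ε * ((4 / 9) ^ i * 2 ^ i) := by rw [pow_succ]; ring
      _ = _ := by rw [← mul_pow]; norm_num
  refine (Finset.sum_le_sum hterm).trans ?_
  rw [← Finset.mul_sum]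
  have hgeom : ∑ k ∈ Finset.range (n + 1), (8 / 9 : ℝ) ^ (n - k) ≤ 9 := by
    have := Finset.sum_range_reflect (fun k => (8 / 9 : ℝ) ^ k) (n + 1)
    simp only [Nat.add_sub_cancel] at this
    rw [this]
    have h := (summable_geometric_of_lt_one (r := (8 / 9 : ℝ)) (by norm_num)
      (by norm_num)).sum_le_tsum (Finset.range (n + 1)) fun _ _ => by positivity
    rw [tsum_geometric_of_lt_one (by norm_num) (by norm_num)] at h
    linarith
  calc _ ≤ δ / c * 2 * σ ε * 9 := by gcongr
    _ = _ := by ring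

/-- Modulus of continuity on the dyadic points of a path whose dyadic increments are bounded by
the level radii. -/
lemma exists_levelRadius_modulus {β c : ℝ} (hβ : 0 < β) (hc : 0 < c) :
    ∃ δ > 0, ∀ (σ f : ℝ → ℝ), (∀ x ∈ Icc (0 : ℝ) 1, 0 ≤ σ x) → ConcaveOn ℝ (Icc 0 1) σ →
      MonotoneOn f (Icc 0 1) → (∀ x ∈ Ioc (0 : ℝ) 1, 0 < f x) →
      MonotoneOn (fun x => σ x / (x ^ β * f x)) (Ioc 0 1) →
      ∀ ε ∈ Ioc (0 : ℝ) 1, ∀ n : ℕ, (1 / 2) ^ (n + 1) < ε → ε ≤ (1 / 2) ^ n →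
      ∀ u : ℝ → ℝ, (∀ k i : ℕ, i < 2 ^ k → |u ((i + 1 : ℝ) / 2 ^ k) - u (i / 2 ^ k)| ≤
        levelRadius δ (2 ^ (β / 2)) n k * (σ ((1 / 2) ^ k) / c)) →
      ∀ L p q : ℕ, p < q → q ≤ 2 ^ L →
        |u (q / 2 ^ L) - u (p / 2 ^ L)| ≤ σ ε / f ε * f (q / 2 ^ L - p / 2 ^ L) := by
  have hθ1 : (1 : ℝ) < 2 ^ (β / 2) := Real.one_lt_rpow (by norm_num) (by positivity)
  set S : ℝ := 2 ^ β * (1 - (2 ^ (β / 2))⁻¹)⁻¹ with hS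
  have hS0 : 0 < S := by
    have : (0 : ℝ) < 1 - (2 ^ (β / 2))⁻¹ := sub_pos.2 (inv_lt_one_of_one_lt₀ hθ1)
    positivity
  set δ := c / (2 * (18 + S)) with hδ
  have hδ0 : 0 < δ := by positivity
  have hδc : 2 * (δ / c * (18 + S)) = 1 := by rw [hδ]; field_simp
  have hδc0 : 0 < δ / c := by positivity
  refine ⟨δ, hδ0, fun σ f hσ hconc hfmono hfpos hmono ε hε n hn hn' u hu L p q hpq hq => ?_⟩
  have hfε := hfpos ε hε
  have hσε := hσ ε ⟨hε.1.le, hε.2⟩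
  have hK0 : 0 ≤ σ ε / f ε := div_nonneg hσε hfε.le
  have hx : ∀ j, ((1 : ℝ) / 2) ^ j ∈ Ioc (0 : ℝ) 1 := fun j =>
    ⟨by positivity, pow_le_one₀ (by norm_num) (by norm_num)⟩
  have ha : ∀ k, 0 ≤ levelRadius δ (2 ^ (β / 2)) n k * (σ ((1 / 2) ^ k) / c) := fun k =>
    mul_nonneg (levelRadius_pos hδ0 (by linarith) n k).le
      (div_nonneg (hσ _ ⟨(hx k).1.le, (hx k).2⟩) hc.le)
  have hfine := fun m (hm : n ≤ m) d =>
    sum_fine_le hβ hδ0 hc hσ hfmono hfpos hmono hε hn hm d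
  refine abs_sub_le_of_dyadic hu ha (g := fun x => σ ε / f ε * f x) (ε := ε) (n := n)
    (fun x hx y hy hxy => mul_le_mul_of_nonneg_left (hfmono hx hy hxy) hK0) hε hn'
    (fun d => ?_) (fun m hm d => ?_) hpq hq
  · have h1 : ∑ k ∈ Finset.range d, levelRadius δ (2 ^ (β / 2)) n k * (σ ((1 / 2) ^ k) / c) ≤
        ∑ k ∈ Finset.range (n + 1 + d),
          levelRadius δ (2 ^ (β / 2)) n k * (σ ((1 / 2) ^ k) / c) :=
      Finset.sum_le_sum_of_subset_of_nonneg (by simp) fun k _ _ => ha k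
    rw [Finset.sum_range_add] at h1
    have h2 := sum_coarse_le (θ := 2 ^ (β / 2)) hδ0 hc hσ hconc hε hn hn'
    have h3 := hfine n le_rfl d
    have h4 : σ ε / f ε * f ((1 / 2) ^ (n + 1)) ≤ σ ε := by
      calc _ ≤ σ ε / f ε * f ε := by
            gcongr
            exact hfmono ⟨(hx _).1.le, (hx _).2⟩ ⟨hε.1.le, hε.2⟩ hn.le
        _ = σ ε := div_mul_cancel₀ _ hfε.ne'
    have h5 := mul_le_mul_of_nonneg_left h4 (by positivity : 0 ≤ δ / c * S)
    change _ ≤ σ ε / f ε * f ε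
    rw [div_mul_cancel₀ _ hfε.ne']
    have h6 : σ ε = 2 * (δ / c * (18 + S)) * σ ε := by rw [hδc, one_mul]
    nlinarith
  · have h3 := hfine m hm d
    have h4 := (hfpos _ (hx (m + 1))).le
    have h5 := mul_nonneg hK0 h4
    have h6 : 2 * (δ / c * S) ≤ 1 := by nlinarith
    calc _ ≤ 2 * (δ / c * S * (σ ε / f ε * f ((1 / 2) ^ (m + 1)))) := by gcongr
      _ ≤ _ := by nlinarith

open ProbabilityTheory in
/-- Finite families of increments of a centered Gaussian process form a Gaussian vector. -/
lemma IsCenteredGaussianProcess.hasGaussianLaw_sub {Ω ι : Type*} [MeasurableSpace Ω]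
    {P : Measure Ω} [Fintype ι] {U : ℝ → Ω → ℝ} (hU : IsCenteredGaussianProcess P U)
    (hUm : ∀ t, Measurable (U t)) (s t : ι → ℝ) :
    HasGaussianLaw (fun ω i => U (t i) ω - U (s i) ω) P := by
  classical
  refine ⟨isGaussian_of_map_eq_gaussianReal fun L => ?_⟩
  let φ : Fin (Fintype.card (ι ⊕ ι)) ≃ ι ⊕ ι := (Fintype.equivFin (ι ⊕ ι)).symm
  let w : ι → ℝ := fun i => L (Pi.single i 1)
  obtain ⟨v, hv⟩ := hU _ (Sum.elim w (fun i => -w i) ∘ φ) (Sum.elim t s ∘ φ)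
  refine ⟨0, v, ?_⟩
  have hm : Measurable fun ω i => U (t i) ω - U (s i) ω :=
    measurable_pi_lambda _ fun i => (hUm _).sub (hUm _)
  rw [Measure.map_map (by fun_prop) hm, ← hv]
  congr 1
  ext ω
  simp only [Function.comp_apply]
  rw [Equiv.sum_comp φ fun x => Sum.elim w (fun i => -w i) x * U (Sum.elim t s x) ω,
    Fintype.sum_sum_type]
  simp only [Sum.elim_inl, Sum.elim_inr]
  rw [← Finset.sum_add_distrib]
  conv_lhs => rw [pi_eq_sum_univ' (fun i => U (t i) ω - U (s i) ω)]
  rw [map_sum]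
  refine Finset.sum_congr rfl fun i _ => ?_
  rw [map_smul, smul_eq_mul]
  simp only [w]
  ring

open ProbabilityTheory in
/-- The law of an increment of a centered Gaussian process. -/
lemma IsCenteredGaussianProcess.exists_map_sub {Ω : Type*} [MeasurableSpace Ω]
    {P : Measure Ω} {U : ℝ → Ω → ℝ} (hU : IsCenteredGaussianProcess P U)
    (hUm : ∀ t, Measurable (U t)) (s t : ℝ) :
    ∃ v : NNReal, P.map (fun ω => U t ω - U s ω) = gaussianReal 0 v ∧
      (v : ℝ) = ∫ ω, (U t ω - U s ω) ^ 2 ∂P := by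
  obtain ⟨v, hv⟩ := hU 2 ![1, -1] ![t, s]
  have hv' : P.map (fun ω => U t ω - U s ω) = gaussianReal 0 v := by
    rw [← hv]
    congr 1
    ext ω
    simp [Fin.sum_univ_two, sub_eq_add_neg]
  refine ⟨v, hv', ?_⟩
  have hm : Measurable fun ω => U t ω - U s ω := (hUm t).sub (hUm s)
  have h1 : ∫ ω, (U t ω - U s ω) ^ 2 ∂P = ∫ x, x ^ 2 ∂(gaussianReal 0 v) := by
    rw [← hv', integral_map hm.aemeasurable (by fun_prop)]
  rw [h1, ← variance_of_integral_eq_zero (X := fun x => x) (by fun_prop)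
    integral_id_gaussianReal, variance_fun_id_gaussianReal]

open ProbabilityTheory in
lemma IsCenteredGaussianProcess.integral_sub_eq_zero {Ω : Type*} [MeasurableSpace Ω]
    {P : Measure Ω} {U : ℝ → Ω → ℝ} (hU : IsCenteredGaussianProcess P U)
    (hUm : ∀ t, Measurable (U t)) (s t : ℝ) : ∫ ω, (U t ω - U s ω) ∂P = 0 := by
  obtain ⟨v, hv, -⟩ := hU.exists_map_sub hUm s t
  have hm : Measurable fun ω => U t ω - U s ω := (hUm t).sub (hUm s)
  have h1 : ∫ ω, (U t ω - U s ω) ∂P = ∫ x, x ∂(gaussianReal 0 v) := by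
    rw [← hv, integral_map hm.aemeasurable (by fun_prop)]
  rw [h1, integral_id_gaussianReal]

/-- Simultaneous small-ball bound for all dyadic increments. -/
lemma IsCenteredGaussianProcess.exp_neg_le_measure_dyadic {Ω : Type*} [MeasurableSpace Ω]
    {P : Measure Ω} [IsProbabilityMeasure P] {U : ℝ → Ω → ℝ} (hU : IsCenteredGaussianProcess P U)
    (hUm : ∀ t, Measurable (U t)) {a e : ℕ → ℝ} {M : ℝ}
    (he : ∀ k i : ℕ, i < 2 ^ k → Real.exp (-e k) ≤
      P.real {ω | |U ((i + 1 : ℝ) / 2 ^ k) ω - U (i / 2 ^ k) ω| ≤ a k})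
    (hM : ∀ L, ∑ k ∈ Finset.range L, 2 ^ k * e k ≤ M) :
    ENNReal.ofReal (Real.exp (-M)) ≤
      P {ω | ∀ k i : ℕ, i < 2 ^ k → |U ((i + 1 : ℝ) / 2 ^ k) ω - U (i / 2 ^ k) ω| ≤ a k} := by
  set A : ℕ → Set Ω := fun L => {ω | ∀ k < L, ∀ i : ℕ, i < 2 ^ k →
    |U ((i + 1 : ℝ) / 2 ^ k) ω - U (i / 2 ^ k) ω| ≤ a k} with hA
  have hAm : ∀ L, MeasurableSet (A L) := fun L => by
    have : A L = ⋂ k < L, ⋂ i : ℕ, ⋂ _ : i < 2 ^ k,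
        {ω | |U ((i + 1 : ℝ) / 2 ^ k) ω - U (i / 2 ^ k) ω| ≤ a k} := by
      ext; simp [hA]
    rw [this]
    refine MeasurableSet.iInter fun k => MeasurableSet.iInter fun _ => MeasurableSet.iInter fun i =>
      MeasurableSet.iInter fun _ => measurableSet_le ?_ measurable_const
    exact ((hUm _).sub (hUm _)).abs
  have hAanti : Antitone A := fun L L' hL ω hω k hk => hω k (hk.trans_le hL)
  have hAeq : {ω | ∀ k i : ℕ, i < 2 ^ k →
      |U ((i + 1 : ℝ) / 2 ^ k) ω - U (i / 2 ^ k) ω| ≤ a k} = ⋂ L, A L := by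
    ext ω
    simp only [hA, mem_iInter, mem_ofPred_eq]
    exact ⟨fun h L k _ i hi => h k i hi, fun h k i hi => h (k + 1) k (Nat.lt_succ_self k) i hi⟩
  rw [hAeq]
  refine ge_of_tendsto' (tendsto_measure_iInter_atTop (fun L => (hAm L).nullMeasurableSet) hAanti
    ⟨0, measure_ne_top _ _⟩) fun L => ?_
  change _ ≤ P (A L)
  rw [ENNReal.ofReal_le_iff_le_toReal (measure_ne_top _ _)]
  let s : (Σ k : Fin L, Fin (2 ^ (k : ℕ))) → ℝ := fun x => (x.2 : ℕ) / 2 ^ (x.1 : ℕ)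
  let t : (Σ k : Fin L, Fin (2 ^ (k : ℕ))) → ℝ := fun x => ((x.2 : ℕ) + 1) / 2 ^ (x.1 : ℕ)
  have hK := khatri_sidak (hU.hasGaussianLaw_sub hUm s t)
    (fun i => (hUm (t i)).sub (hUm (s i))) (fun i => hU.integral_sub_eq_zero hUm (s i) (t i))
    (fun x => a x.1) Finset.univ
  have hset : {ω | ∀ x ∈ (Finset.univ : Finset (Σ k : Fin L, Fin (2 ^ (k : ℕ)))),
      |U (t x) ω - U (s x) ω| ≤ a x.1} = A L := by
    ext ω
    simp only [hA, mem_ofPred_eq, Finset.mem_univ, forall_true_left]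
    exact ⟨fun h k hk i hi => h ⟨⟨k, hk⟩, ⟨i, hi⟩⟩, fun h x => h x.1 x.1.2 x.2 x.2.2⟩
  rw [hset] at hK
  refine le_trans ?_ hK
  calc Real.exp (-M) ≤ Real.exp (-∑ k ∈ Finset.range L, 2 ^ k * e k) :=
        Real.exp_le_exp.2 (neg_le_neg (hM L))
    _ = ∏ x : (Σ k : Fin L, Fin (2 ^ (k : ℕ))), Real.exp (-e x.1) := by
        rw [Fintype.prod_sigma, ← Finset.sum_neg_distrib, Real.exp_sum,
          ← Fin.prod_univ_eq_prod_range (fun k => Real.exp (-(2 ^ k * e k)))]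
        refine Finset.prod_congr rfl fun k _ => ?_
        simp only
        rw [Finset.prod_const, Finset.card_univ, Fintype.card_fin, ← Real.exp_nat_mul]
        push_cast
        congr 1
        ring
    _ ≤ _ := Finset.prod_le_prod (fun _ _ => (Real.exp_pos _).le) fun x _ =>
        he x.1 x.2 x.2.2

/-- A closed modulus of continuity extends to the closure of the graph. -/
lemma abs_sub_le_of_mem_closure_graph {u g : ℝ → ℝ} (hg : Continuous g) {E : Set ℝ}
    (h : ∀ s ∈ E, ∀ t ∈ E, |u t - u s| ≤ g |t - s|) {s t : ℝ}
    (hs : (s, u s) ∈ closure ((fun x => (x, u x)) '' E))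
    (ht : (t, u t) ∈ closure ((fun x => (x, u x)) '' E)) : |u t - u s| ≤ g |t - s| := by
  set G := (fun x => (x, u x)) '' E
  have hclosed : IsClosed {z : (ℝ × ℝ) × (ℝ × ℝ) | |z.2.2 - z.1.2| ≤ g |z.2.1 - z.1.1|} :=
    isClosed_le (by fun_prop) (by fun_prop)
  have hsub : G ×ˢ G ⊆ {z : (ℝ × ℝ) × (ℝ × ℝ) | |z.2.2 - z.1.2| ≤ g |z.2.1 - z.1.1|} := by
    rintro ⟨-, -⟩ ⟨⟨x, hx, rfl⟩, ⟨y, hy, rfl⟩⟩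
    exact h x hx y hy
  have : ((s, u s), (t, u t)) ∈ closure (G ×ˢ G) := by
    rw [closure_prod_eq]; exact ⟨hs, ht⟩
  exact closure_minimal hsub hclosed this

/-- The dyadic points of `[0,1]`. -/
def dyadicUnit : Set ℝ := {x | ∃ L p : ℕ, p ≤ 2 ^ L ∧ x = p / 2 ^ L}

/-- A separable process which is mean-square continuous with some modulus is determined by its
values on the dyadic points. -/
lemma IsSeparableProcess.ae_mem_closure_graph {Ω : Type*} [MeasurableSpace Ω]
    {P : Measure Ω} [IsProbabilityMeasure P] {U : ℝ → Ω → ℝ} (hS : IsSeparableProcess P U)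
    (hU : IsCenteredGaussianProcess P U) (hUm : ∀ t, Measurable (U t)) {g : ℝ → ℝ}
    (hg : Continuous g) (hg0 : g 0 = 0)
    (hUg : ∀ t h : ℝ, 0 ≤ t → 0 ≤ h → t + h ≤ 1 →
      ∫ ω, (U (t + h) ω - U t ω) ^ 2 ∂P ≤ g h) :
    ∀ᵐ ω ∂P, ∀ t ∈ Icc (0 : ℝ) 1,
      (t, U t ω) ∈ closure ((fun x => (x, U x ω)) '' dyadicUnit) := by
  obtain ⟨D, hDc, hD, hsep⟩ := hS
  have hdense : ∀ d ∈ D, ∀ᵐ ω ∂P,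
      (d, U d ω) ∈ closure ((fun x => (x, U x ω)) '' dyadicUnit) := by
    intro d hd
    obtain ⟨hd0, hd1⟩ := hD hd
    let x : ℕ → ℝ := fun L => (⌊d * 2 ^ L⌋₊ : ℝ) / 2 ^ L
    have hxd : ∀ L, x L ≤ d := fun L => by
      rw [div_le_iff₀ (by positivity)]
      exact Nat.floor_le (by positivity)
    have hx0 : ∀ L, 0 ≤ x L := fun L => by positivity
    have hxmem : ∀ L, x L ∈ dyadicUnit := fun L => by
      refine ⟨L, _, ?_, rfl⟩
      have : (⌊d * 2 ^ L⌋₊ : ℝ) ≤ 2 ^ L := by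
        have := (div_le_iff₀ (by positivity)).1 ((hxd L).trans hd1)
        linarith
      exact_mod_cast this
    have hxlim : Tendsto x atTop (nhds d) := by
      have hlow : ∀ L, d - (1 / 2) ^ L ≤ x L := fun L => by
        have := (Nat.lt_floor_add_one (d * 2 ^ L)).le
        rw [le_div_iff₀ (by positivity), sub_mul, ← mul_pow]
        norm_num
        linarith
      refine tendsto_of_tendsto_of_tendsto_of_le_of_le ?_ tendsto_const_nhds hlow hxd
      simpa using (tendsto_const_nhds (x := d)).sub
        (tendsto_pow_atTop_nhds_zero_of_lt_one (r := (1 / 2 : ℝ)) (by norm_num) (by norm_num))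
    have hmem : ∀ L, MemLp (fun ω => U d ω - U (x L) ω) 2 P := fun L => by
      have := (hU.hasGaussianLaw_sub hUm (fun _ : Unit => x L) fun _ => d).eval ()
      exact this.memLp_two
    have hmeas : TendstoInMeasure P (fun L => U (x L)) atTop (U d) := by
      refine tendstoInMeasure_of_tendsto_eLpNorm (p := 2) (by norm_num)
        (fun L => (hUm _).aestronglyMeasurable) (hUm _).aestronglyMeasurable ?_
      have hb : Tendsto (fun L => ENNReal.ofReal (Real.sqrt (g (d - x L)))) atTop (nhds 0) := by
        have h1 : Tendsto (fun L => g (d - x L)) atTop (nhds 0) := by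
          have : Tendsto (fun L => d - x L) atTop (nhds 0) := by
            simpa using (tendsto_const_nhds (x := d)).sub hxlim
          have h := (hg.tendsto 0).comp this
          rwa [hg0] at h
        have h2 := ENNReal.tendsto_ofReal ((Real.continuous_sqrt.tendsto 0).comp h1)
        simpa using h2
      refine tendsto_of_tendsto_of_tendsto_of_le_of_le tendsto_const_nhds hb
        (fun _ => zero_le) fun L => ?_
      change eLpNorm (U (x L) - U d) 2 P ≤ _
      rw [eLpNorm_sub_comm]
      change eLpNorm (fun ω => U d ω - U (x L) ω) 2 P ≤ _
      rw [(hmem L).eLpNorm_eq_integral_rpow_norm (by norm_num) (by norm_num)]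
      apply ENNReal.ofReal_le_ofReal
      have := hUg (x L) (d - x L) (hx0 L) (by linarith [hxd L]) (by linarith)
      rw [add_sub_cancel] at this
      simp only [ENNReal.toReal_ofNat, Real.rpow_ofNat, Real.norm_eq_abs, sq_abs]
      rw [Real.sqrt_eq_rpow, one_div]
      exact Real.rpow_le_rpow (integral_nonneg fun _ => sq_nonneg _) this (by norm_num)
    obtain ⟨ns, hns, hae⟩ := hmeas.exists_seq_tendsto_ae
    filter_upwards [hae] with ω hω
    exact mem_closure_of_tendsto ((hxlim.comp hns.tendsto_atTop).prodMk_nhds hω)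
      (Eventually.of_forall fun i => ⟨_, hxmem (ns i), rfl⟩)
  filter_upwards [hsep, (ae_ball_iff hDc).2 hdense] with ω hω hωD t ht
  have hsub : closure ((fun x => (x, U x ω)) '' D) ⊆
      closure ((fun x => (x, U x ω)) '' dyadicUnit) := by
    refine closure_minimal ?_ isClosed_closure
    rintro _ ⟨d, hd, rfl⟩
    exact hωD d hd
  refine hsub (Metric.mem_closure_iff.2 fun η hη => ?_)
  obtain ⟨_, ⟨d, ⟨hdD, hdt⟩, rfl⟩, hdist⟩ := Metric.mem_closure_iff.1 (hω t ht η hη) η hη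
  refine ⟨_, ⟨d, hdD, rfl⟩, ?_⟩
  rw [Prod.dist_eq]
  refine max_lt ?_ hdist
  rw [Real.dist_eq, abs_lt]
  constructor <;> linarith [hdt.1, hdt.2]

/-- A modulus of continuity on ordered pairs of dyadic points of a common level gives a modulus
for all pairs of dyadic points of `[0,1]`. -/
lemma abs_sub_le_of_mem_dyadicUnit {u g : ℝ → ℝ} (hg0 : 0 ≤ g 0)
    (h : ∀ L p q : ℕ, p < q → q ≤ 2 ^ L →
      |u (q / 2 ^ L) - u (p / 2 ^ L)| ≤ g (q / 2 ^ L - p / 2 ^ L))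
    {s t : ℝ} (hs : s ∈ dyadicUnit) (ht : t ∈ dyadicUnit) : |u t - u s| ≤ g |t - s| := by
  wlog hst : s ≤ t generalizing s t
  · rw [abs_sub_comm, abs_sub_comm t]
    exact this ht hs (le_of_not_ge hst)
  rcases hst.eq_or_lt with rfl | hlt
  · simpa using hg0
  obtain ⟨L, p, hp, rfl⟩ := hs
  obtain ⟨L', q, hq, rfl⟩ := ht
  have e1 : (p : ℝ) / 2 ^ L = ((p * 2 ^ L' : ℕ) : ℝ) / 2 ^ (L + L') := by
    push_cast
    rw [pow_add]
    field_simp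
  have e2 : (q : ℝ) / 2 ^ L' = ((q * 2 ^ L : ℕ) : ℝ) / 2 ^ (L + L') := by
    push_cast
    rw [pow_add]
    field_simp
  rw [abs_of_pos (sub_pos.2 hlt)]
  rw [e1, e2] at hlt ⊢
  refine h _ _ _ ?_ ?_
  · rw [div_lt_div_iff_of_pos_right (by positivity)] at hlt
    exact_mod_cast hlt
  · rw [pow_add, mul_comm]
    exact Nat.mul_le_mul_left _ hq

/-- **General small-ball estimate for separable centered Gaussian processes**
(Kuelbs–Li–Shao type).  Given `β > 0` and `c_* > 0`, there is a constant `M_β > 0`,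
depending only on `β` and `c_*`, such that: for every separable centered Gaussian process `U`
on `[0,1]` with `U_0 = 0`, every `V` with `√V` concave and `√(V_h) ≥ c_* √(E[(U_{t+h}-U_t)²])`
whenever `t + h ≤ 1`, and every nondecreasing `f ∈ C_0[0,1]` strictly positive on `(0,1]` such
that `ε ↦ √(V_ε)/(ε^β f(ε))` is nondecreasing on `(0,1]`, one has for all `ε ∈ (0,1]`
`P( sup_{s ≠ t} |U_t - U_s| / f(|t-s|) ≤ √(V_ε)/f(ε) ) ≥ exp(-M_β/ε)`. -/
theorem stmt_3 (β cstar : ℝ) (hβ : 0 < β) (hc : 0 < cstar) :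
    ∃ Mβ > 0, ∀ (Ω : Type) [MeasurableSpace Ω] (P : Measure Ω), IsProbabilityMeasure P →
      ∀ U : ℝ → Ω → ℝ, (∀ t, Measurable (U t)) → (∀ ω, U 0 ω = 0) →
        IsCenteredGaussianProcess P U → IsSeparableProcess P U →
      ∀ V : ℝ → ℝ, (∀ h ∈ Icc (0:ℝ) 1, 0 ≤ V h) →
        ConcaveOn ℝ (Icc 0 1) (fun h => Real.sqrt (V h)) →
        (∀ t h : ℝ, 0 ≤ t → 0 ≤ h → t + h ≤ 1 →
          cstar * Real.sqrt (∫ ω, (U (t + h) ω - U t ω) ^ 2 ∂P) ≤ Real.sqrt (V h)) →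
      ∀ f : ℝ → ℝ, ContinuousOn f (Icc 0 1) → f 0 = 0 → MonotoneOn f (Icc 0 1) →
        (∀ x ∈ Ioc (0:ℝ) 1, 0 < f x) →
        MonotoneOn (fun ε => Real.sqrt (V ε) / (ε ^ β * f ε)) (Ioc 0 1) →
      ∀ ε ∈ Ioc (0:ℝ) 1,
        ENNReal.ofReal (Real.exp (-(Mβ / ε))) ≤
          P {ω | ∀ s ∈ Icc (0:ℝ) 1, ∀ t ∈ Icc (0:ℝ) 1, s ≠ t →
            |U t ω - U s ω| ≤ (Real.sqrt (V ε) / f ε) * f |t - s|} := by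
  obtain ⟨δ, hδ, hmod⟩ := exists_levelRadius_modulus hβ hc
  obtain ⟨D, hD, hcost⟩ := exists_exp_neg_le_gaussianReal_levelRadius hβ hδ
  refine ⟨8 * D, by positivity, ?_⟩
  intro Ω _ P hP U hUm _ hU hS V _ hconc hV f hf hf0 hfmono hfpos hmono ε hε
  set σ : ℝ → ℝ := fun h => Real.sqrt (V h) with hσ
  have hσ0 : ∀ x, 0 ≤ σ x := fun x => Real.sqrt_nonneg _
  obtain ⟨n, hn, hn'⟩ := exists_nat_pow_near_of_lt_one hε.1 hε.2
    (by norm_num : (0 : ℝ) < 1 / 2) (by norm_num)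
  let F : ℝ → ℝ := fun x => f (projIcc (0 : ℝ) 1 zero_le_one x)
  have hF : Continuous F := hf.comp_continuous
    (continuous_subtype_val.comp continuous_projIcc) fun x => (projIcc (0 : ℝ) 1 _ x).2
  have hFf : ∀ x ∈ Icc (0 : ℝ) 1, F x = f x := fun x hx => by
    simp only [F]
    rw [projIcc_of_mem _ hx]
  have hF0 : F 0 = 0 := (hFf 0 ⟨le_rfl, zero_le_one⟩).trans hf0
  have hclosure := hS.ae_mem_closure_graph hU hUm
    (g := fun h => (σ 1 / f 1 * (|h| ^ β * F h) / cstar) ^ 2)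
    ((((continuous_const.mul ((continuous_abs.rpow_const fun _ => Or.inr hβ.le).mul hF)).div_const
      _).pow 2)) (by simp [hF0]) (fun t h ht hh hth => by
      rcases hh.eq_or_lt with rfl | hpos
      · simp only [add_zero, sub_self]
        simpa using sq_nonneg _
      · have hh1 : h ∈ Ioc (0 : ℝ) 1 := ⟨hpos, by linarith⟩
        have h1 := hmono hh1 ⟨zero_lt_one, le_rfl⟩ hh1.2
        have hfh := hfpos h hh1
        simp only [Real.one_rpow, one_mul] at h1
        rw [div_le_iff₀ (by positivity)] at h1
        have h2 := hV t h ht hh hth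
        have h3 : 0 ≤ ∫ ω, (U (t + h) ω - U t ω) ^ 2 ∂P := integral_nonneg fun _ => sq_nonneg _
        rw [← Real.sq_sqrt h3, abs_of_pos hpos, hFf h ⟨hpos.le, hh1.2⟩]
        refine pow_le_pow_left₀ (Real.sqrt_nonneg _) ?_ 2
        rw [le_div_iff₀ hc, mul_comm]
        exact h2.trans h1)
  set a : ℕ → ℝ := fun k => levelRadius δ (2 ^ (β / 2)) n k * (σ ((1 / 2) ^ k) / cstar) with ha
  have hprob := hU.exp_neg_le_measure_dyadic hUm (a := a)
    (e := fun k => D * (2 ^ n / 2 ^ k) * (3 / 4) ^ ((n - k) + (k - n))) (M := 8 * D / ε)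
    (fun k i hi => by
      obtain ⟨v, hv, hv2⟩ := hU.exists_map_sub hUm (i / 2 ^ k) ((i + 1 : ℝ) / 2 ^ k)
      have hm : Measurable fun ω => U ((i + 1 : ℝ) / 2 ^ k) ω - U (i / 2 ^ k) ω :=
        (hUm _).sub (hUm _)
      have hle : Real.sqrt v ≤ σ ((1 / 2) ^ k) / cstar := by
        have hi' : (i : ℝ) + 1 ≤ 2 ^ k := by exact_mod_cast hi
        have e : (i : ℝ) / 2 ^ k + (1 / 2) ^ k = (i + 1) / 2 ^ k := by
          rw [add_div, one_div_pow]
        have := hV (i / 2 ^ k) ((1 / 2) ^ k) (by positivity) (by positivity)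
          (by rw [e, div_le_one (by positivity)]; exact hi')
        rw [e, ← hv2] at this
        rwa [le_div_iff₀ hc, mul_comm]
      have h := hcost n k v _ hle
      rw [← hv, map_measureReal_apply hm (measurableSet_le (by fun_prop) (by fun_prop))] at h
      exact h)
    (fun L => by
      have e : ∀ k : ℕ, 2 ^ k * (D * (2 ^ n / 2 ^ k) * (3 / 4) ^ ((n - k) + (k - n))) =
          D * 2 ^ n * (3 / 4 : ℝ) ^ ((n - k) + (k - n)) := fun k => by field_simp
      simp only [e]
      rw [← Finset.mul_sum]
      have h1 := sum_pow_dist_le (ρ := 3 / 4) (by norm_num) (by norm_num) n L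
      have h2 : (2 : ℝ) ^ n ≤ 1 / ε := by
        rw [one_div_pow] at hn'
        rwa [le_one_div (by positivity) hε.1]
      calc _ ≤ D * (1 / ε) * (2 * (1 - 3 / 4)⁻¹) := by
            have := hε.1
            gcongr
        _ = 8 * D / ε := by ring)
  refine hprob.trans (measure_mono_ae ?_)
  filter_upwards [hclosure] with ω hω
  intro hA s hs t ht _
  have hK0 : 0 ≤ σ ε / f ε := div_nonneg (hσ0 ε) (hfpos ε hε).le
  have hdy := hmod σ f (fun x _ => hσ0 x) hconc hfmono hfpos hmono ε hε n hn hn'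
    (fun x => U x ω) hA
  have hts : |t - s| ∈ Icc (0 : ℝ) 1 :=
    ⟨abs_nonneg _, abs_le.2 ⟨by linarith [hs.2, ht.1], by linarith [hs.1, ht.2]⟩⟩
  have := abs_sub_le_of_mem_closure_graph (u := fun x => U x ω) (g := fun x => σ ε / f ε * F x)
    (continuous_const.mul hF) (E := dyadicUnit)
    (fun s hs t ht => abs_sub_le_of_mem_dyadicUnit (u := fun x => U x ω)
      (g := fun x => σ ε / f ε * F x) (by simp [hF0])
      (fun L p q hpq hq => by
        have h2L : (0 : ℝ) < 2 ^ L := by positivity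
        have hpq' : (p : ℝ) ≤ q := by exact_mod_cast hpq.le
        have hq' : (q : ℝ) ≤ 2 ^ L := by exact_mod_cast hq
        have hmem : (q : ℝ) / 2 ^ L - p / 2 ^ L ∈ Icc (0 : ℝ) 1 := by
          rw [← sub_div]
          refine ⟨div_nonneg (by linarith) h2L.le, (div_le_one h2L).2 ?_⟩
          linarith [(Nat.cast_nonneg p : (0 : ℝ) ≤ p)]
        simp only [hFf _ hmem]
        exact hdy L p q hpq hq) hs ht)
    (hω s hs) (hω t ht)
  simpa only [hFf _ hts] using this

end
end

section
/- Let 0 < α < 1/2. There exists a constant C > 0 depending only on α such that for all 0 < h ≤ 1 and all 0 ≤ t ≤ 1, ∫_0^t ( (h + x)^{−α} − x^{−α} )² dx ≤ C ( h^{1−2α} + h^{2−2α} ); in particular ∫_0^t ( (h + x)^{−α} − x^{−α} )² dx ≤ C' h^{1−2α} for a constant C' depending only on α. -/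
open Set

/-- The squared increment of `x ↦ x ^ (-α)` is dominated by the derivative of
`x ↦ h ^ (1 - 2 * α) / (1 - 2 * α) * (x / (h + x)) ^ (1 - 2 * α)`. -/
lemma sq_rpow_neg_increment_le {α h x : ℝ} (hα0 : 0 < α) (hα : α < 1 / 2) (hh : 0 < h)
    (hx : 0 < x) :
    ((h + x) ^ (-α) - x ^ (-α)) ^ 2 ≤
      (h * (x / (h + x))) ^ (-(2 * α)) * (1 - x / (h + x)) ^ 2 := by
  have hhx : 0 < h + x := by positivity
  set u := x / (h + x) with hu
  have hu0 : 0 < u := by positivity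
  have hu1 : u ≤ 1 := (div_le_one hhx).2 (by linarith)
  have hshift : (h + x) ^ (-α) = x ^ (-α) * u ^ α := by
    rw [hu, Real.div_rpow hx.le hhx.le, Real.rpow_neg hhx.le, Real.rpow_neg hx.le]
    have : x ^ α ≠ 0 := (Real.rpow_pos_of_pos hx α).ne'
    field_simp
  have hsq : (x ^ (-α)) ^ 2 = x ^ (-(2 * α)) := by
    rw [← Real.rpow_natCast, ← Real.rpow_mul hx.le]
    congr 1
    push_cast
    ring
  have hle : u ≤ u ^ α := by
    simpa using Real.rpow_le_rpow_of_exponent_ge hu0 hu1 (by linarith : α ≤ 1)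
  have hle1 : u ^ α ≤ 1 := Real.rpow_le_one hu0.le hu1 hα0.le
  have hbase : h * u ≤ x := by
    rw [hu, ← mul_div_assoc, div_le_iff₀ hhx]
    nlinarith
  calc ((h + x) ^ (-α) - x ^ (-α)) ^ 2 = x ^ (-(2 * α)) * (1 - u ^ α) ^ 2 := by
        rw [hshift, ← hsq]; ring
    _ ≤ (h * u) ^ (-(2 * α)) * (1 - u) ^ 2 := by
        refine mul_le_mul ?_ ?_ (by positivity) (by positivity)
        · exact Real.rpow_le_rpow_of_nonpos (by positivity) hbase (by linarith)
        · exact pow_le_pow_left₀ (by linarith) (by linarith) 2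

lemma hasDerivAt_rpow_div_add {α h x : ℝ} (hα : α < 1 / 2) (hh : 0 < h) (hx : 0 < x) :
    HasDerivAt (fun y ↦ h ^ (1 - 2 * α) / (1 - 2 * α) * (y / (h + y)) ^ (1 - 2 * α))
      ((h * (x / (h + x))) ^ (-(2 * α)) * (1 - x / (h + x)) ^ 2) x := by
  have hhx : 0 < h + x := by positivity
  have hc : 1 - 2 * α ≠ 0 := by linarith
  have hd : HasDerivAt (fun y ↦ y / (h + y)) ((1 * (h + x) - x * 1) / (h + x) ^ 2) x :=
    (hasDerivAt_id x).div ((hasDerivAt_id x).const_add h) hhx.ne'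
  have hu0 : 0 < x / (h + x) := by positivity
  refine ((hd.rpow_const (p := 1 - 2 * α) (Or.inl hu0.ne')).const_mul
    (h ^ (1 - 2 * α) / (1 - 2 * α))).congr_deriv ?_
  have hexp : (1 - 2 * α) - 1 = -(2 * α) := by ring
  have hpow : h ^ (1 - 2 * α) = h * h ^ (-(2 * α)) := by
    rw [sub_eq_add_neg, Real.rpow_add hh, Real.rpow_one]
  rw [hexp, hpow, Real.mul_rpow hh.le hu0.le]
  generalize (x / (h + x)) ^ (-(2 * α)) = a
  field_simp
  ring

lemma integral_sq_rpow_neg_increment_le {α h t : ℝ} (hα0 : 0 < α) (hα : α < 1 / 2) (hh : 0 < h)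
    (ht : 0 ≤ t) :
    (∫ x in (0 : ℝ)..t, ((h + x) ^ (-α) - x ^ (-α)) ^ 2) ≤
      1 / (1 - 2 * α) * h ^ (1 - 2 * α) := by
  have hc : 0 < 1 - 2 * α := by linarith
  by_cases hint : IntervalIntegrable (fun x ↦ ((h + x) ^ (-α) - x ^ (-α)) ^ 2)
      MeasureTheory.volume 0 t
  · have hcont : ContinuousOn
        (fun y ↦ h ^ (1 - 2 * α) / (1 - 2 * α) * (y / (h + y)) ^ (1 - 2 * α)) (Icc 0 t) := by
      refine continuousOn_const.mul (ContinuousOn.rpow_const ?_ fun _ _ ↦ Or.inr hc.le)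
      refine continuousOn_id.div (by fun_prop) fun y hy ↦ ?_
      have := hy.1
      positivity
    have hbound := intervalIntegral.integral_le_sub_of_hasDeriv_right_of_le ht hcont
      (fun x hx ↦ (hasDerivAt_rpow_div_add hα hh hx.1).hasDerivWithinAt)
      ((intervalIntegrable_iff_integrableOn_Icc_of_le ht).1 hint)
      (fun x hx ↦ sq_rpow_neg_increment_le hα0 hα hh hx.1)
    have hle : (t / (h + t)) ^ (1 - 2 * α) ≤ 1 :=
      Real.rpow_le_one (by positivity) ((div_le_one (by positivity)).2 (by linarith)) hc.le
    rw [zero_div, Real.zero_rpow hc.ne', mul_zero, sub_zero] at hbound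
    calc _ ≤ h ^ (1 - 2 * α) / (1 - 2 * α) * (t / (h + t)) ^ (1 - 2 * α) := hbound
      _ ≤ h ^ (1 - 2 * α) / (1 - 2 * α) * 1 := by gcongr
      _ = 1 / (1 - 2 * α) * h ^ (1 - 2 * α) := by ring
  · rw [intervalIntegral.integral_undef hint]
    positivity

/-- **An elementary fractional-increment integral estimate.**
For `0 < α < 1/2` there is `C > 0` depending only on `α` such that for all
`0 < h ≤ 1` and `0 ≤ t ≤ 1`,
`∫_0^t ((h+x)^{-α} - x^{-α})² dx ≤ C (h^{1-2α} + h^{2-2α})`; in particular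
`∫_0^t ((h+x)^{-α} - x^{-α})² dx ≤ C' h^{1-2α}` for some `C'` depending only on `α`. -/
theorem stmt_18 (α : ℝ) (hα0 : 0 < α) (hα : α < 1/2) :
    (∃ C > 0, ∀ h ∈ Set.Ioc (0:ℝ) 1, ∀ t ∈ Set.Icc (0:ℝ) 1,
      (∫ x in (0:ℝ)..t, ((h + x) ^ (-α) - x ^ (-α)) ^ 2) ≤
        C * (h ^ (1 - 2*α) + h ^ (2 - 2*α))) ∧
    (∃ C' > 0, ∀ h ∈ Set.Ioc (0:ℝ) 1, ∀ t ∈ Set.Icc (0:ℝ) 1,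
      (∫ x in (0:ℝ)..t, ((h + x) ^ (-α) - x ^ (-α)) ^ 2) ≤ C' * h ^ (1 - 2*α)) := by
  have hc : 0 < 1 / (1 - 2 * α) := one_div_pos.2 (by linarith)
  refine ⟨⟨_, hc, fun h hh t ht ↦ ?_⟩, ⟨_, hc, fun h hh t ht ↦
    integral_sq_rpow_neg_increment_le hα0 hα hh.1 ht.1⟩⟩
  refine (integral_sq_rpow_neg_increment_le hα0 hα hh.1 ht.1).trans ?_
  exact mul_le_mul_of_nonneg_left
    (le_add_of_nonneg_right (Real.rpow_nonneg hh.1.le _)) hc.le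
end
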